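/- Let g : [0,∞) → [0,1] be non-increasing with 0 < C := ∫_{ℝ²} g(‖x‖) dx < ∞ and with g(x) = o(1/(x² log² x)) as x → ∞, let b ∈ ℝ, and let k ≥ 1 be a fixed integer. Then lim inf_{ρ→∞} (λ_ρ^k / k!) · ∫_{A_ρ^k} exp(− λ_ρ ∫_{A_ρ} g₂(y; x₁, …, x_k) dy) d(x₁, …, x_k) ≥ e^{−k b} / k!, where λ_ρ := (log ρ + b)/C, r_ρ := √((log ρ + b)/(C ρ)) and A_ρ := [−1/(2 r_ρ), 1/(2 r_ρ)]². -/

import Mathlib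

open MeasureTheory Real Filter Asymptotics

/-- `C = ∫_{ℝ²} g(‖x‖) dx`. -/
noncomputable def Cg (g : ℝ → ℝ) : ℝ := ∫ x : EuclideanSpace ℝ (Fin 2), g ‖x‖

/-- `λ_ρ = (log ρ + b)/C`. -/
noncomputable def lamDen (g : ℝ → ℝ) (b ρ : ℝ) : ℝ := (Real.log ρ + b) / Cg g

/-- `r_ρ = √((log ρ + b)/(C ρ))`. -/
noncomputable def rRho (g : ℝ → ℝ) (b ρ : ℝ) : ℝ :=
  Real.sqrt ((Real.log ρ + b) / (Cg g * ρ))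

/-- The square `A_ρ = [−1/(2 r_ρ), 1/(2 r_ρ)]² ⊂ ℝ²`. -/
def sqA (g : ℝ → ℝ) (b ρ : ℝ) : Set (EuclideanSpace ℝ (Fin 2)) :=
  {x | ∀ i, x i ∈ Set.Icc (-(1 / (2 * rRho g b ρ))) (1 / (2 * rRho g b ρ))}

/-- The `k`-fold integral
`∫_{A_ρ^k} exp(−λ_ρ ∫_{A_ρ} g₂(y; x₁,…,x_k) dy) d(x₁,…,x_k)`, where
`g₂(y; x₁,…,x_k) = 1 − ∏ᵢ (1 − g(‖y − xᵢ‖))`. -/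
noncomputable def compInt (g : ℝ → ℝ) (b ρ : ℝ) (k : ℕ) : ℝ :=
  ∫ x : Fin k → EuclideanSpace ℝ (Fin 2),
    Real.exp (-(lamDen g b ρ *
      ∫ y in sqA g b ρ, (1 - ∏ i, (1 - g ‖y - x i‖))))
    ∂(Measure.pi fun _ => volume.restrict (sqA g b ρ))

/-- The Euclidean plane. -/
abbrev Plane := EuclideanSpace ℝ (Fin 2)

/-- An antitone, `[0,1]`-valued radial connection function which is integrable over the plane. -/
structure IsConnection (g : ℝ → ℝ) : Prop where
  anti : Antitone g
  nonneg : ∀ x, 0 ≤ g x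
  le_one : ∀ x, g x ≤ 1
  int : Integrable (fun x : Plane => g ‖x‖)

/-- The centred square of side `2 * L`. -/
def square (L : ℝ) : Set Plane := {x | ∀ i, x i ∈ Set.Icc (-L) L}

/-- The probability that `y` is connected to none of the points `c j`. -/
noncomputable def surv (g : ℝ → ℝ) {m : ℕ} (c : Fin m → Plane) (y : Plane) : ℝ :=
  ∏ j, (1 - g ‖y - c j‖)

/-- The integral over the square of the probability to be connected to some `c j` or `x i`. -/
noncomputable def hit (g : ℝ → ℝ) (L : ℝ) {m n : ℕ} (c : Fin m → Plane) (x : Fin n → Plane) : ℝ :=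
  ∫ y in square L, (1 - surv g c y * surv g x y)

/-- The Boltzmann weight `exp (-lam * hit)`. -/
noncomputable def weight (g : ℝ → ℝ) (lam L : ℝ) {m n : ℕ} (c : Fin m → Plane)
    (x : Fin n → Plane) : ENNReal :=
  ENNReal.ofReal (Real.exp (-(lam * hit g L c x)))

/-- Lebesgue measure on the square, with density `lam`. -/
noncomputable def intensity (lam L : ℝ) : Measure Plane :=
  ENNReal.ofReal lam • volume.restrict (square L)

/-- The total weight of configurations of `n` points, given the points `c`. -/
noncomputable def partFun (g : ℝ → ℝ) (lam L : ℝ) {m : ℕ} (c : Fin m → Plane) (n : ℕ) : ENNReal :=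
  ∫⁻ x : Fin n → Plane, weight g lam L c x ∂(Measure.pi fun _ => intensity lam L)

lemma square_eq_preimage (L : ℝ) :
    square L = (WithLp.ofLp : Plane → (Fin 2 → ℝ)) ⁻¹'
      (Set.univ.pi fun _ => Set.Icc (-L) L) := by
  ext x; simp [square, -Set.pi_univ_Icc]

lemma measurableSet_square (L : ℝ) : MeasurableSet (square L) := by
  rw [square_eq_preimage]
  exact (EuclideanSpace.volume_preserving_symm_measurableEquiv_toLp (Fin 2)).measurable
    (MeasurableSet.univ_pi fun _ => measurableSet_Icc)

lemma volume_square (L : ℝ) : volume (square L) = ENNReal.ofReal (2 * L) ^ 2 := by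
  rw [square_eq_preimage, (PiLp.volume_preserving_ofLp (Fin 2)).measure_preimage
    (MeasurableSet.univ_pi fun _ => measurableSet_Icc).nullMeasurableSet, volume_pi_pi]
  simp [two_mul, pow_two]

lemma volume_square_lt_top (L : ℝ) : volume (square L) < ⊤ := by
  rw [volume_square]; exact ENNReal.pow_lt_top ENNReal.ofReal_lt_top

instance (L : ℝ) : IsFiniteMeasure (volume.restrict (square L)) :=
  ⟨by simpa using volume_square_lt_top L⟩

instance (lam L : ℝ) : IsFiniteMeasure (intensity lam L) := by
  refine ⟨?_⟩
  rw [intensity, Measure.smul_apply, Measure.restrict_apply_univ, smul_eq_mul]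
  exact ENNReal.mul_lt_top ENNReal.ofReal_lt_top (volume_square_lt_top L)

namespace IsConnection

variable {g : ℝ → ℝ}

lemma measurable (hg : IsConnection g) : Measurable g := hg.anti.measurable

lemma surv_nonneg (hg : IsConnection g) {m : ℕ} (c : Fin m → Plane) (y : Plane) :
    0 ≤ surv g c y :=
  Finset.prod_nonneg fun j _ => by linarith [hg.le_one ‖y - c j‖]

lemma surv_le_one (hg : IsConnection g) {m : ℕ} (c : Fin m → Plane) (y : Plane) :
    surv g c y ≤ 1 :=
  Finset.prod_le_one (fun j _ => by linarith [hg.le_one ‖y - c j‖])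
    fun j _ => by linarith [hg.nonneg ‖y - c j‖]

lemma one_sub_surv_le (hg : IsConnection g) {m : ℕ} (c : Fin m → Plane) (y : Plane) :
    1 - surv g c y ≤ ∑ j, g ‖y - c j‖ := by
  induction m with
  | zero => simp [surv]
  | succ m ih =>
    have h := ih (fun j => c j.succ)
    rw [surv, Fin.prod_univ_succ, Fin.sum_univ_succ]
    have h1 := hg.surv_le_one (fun j => c j.succ) y
    have h0 := hg.surv_nonneg (fun j => c j.succ) y
    have h2 := hg.nonneg ‖y - c 0‖
    simp only [surv] at h h1 h0
    nlinarith

lemma measurable_surv (hg : IsConnection g) (m : ℕ) :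
    Measurable fun p : (Fin m → Plane) × Plane => surv g p.1 p.2 := by
  have := hg.measurable
  unfold surv
  fun_prop

lemma measurable_surv_right (hg : IsConnection g) {m : ℕ} (c : Fin m → Plane) :
    Measurable (surv g c) := by
  have := hg.measurable
  unfold surv
  fun_prop

lemma integrableOn_hit (hg : IsConnection g) {m n : ℕ} (c : Fin m → Plane) (x : Fin n → Plane)
    (L : ℝ) : IntegrableOn (fun y => 1 - surv g c y * surv g x y) (square L) := by
  have h1 := hg.measurable_surv_right c
  have h2 := hg.measurable_surv_right x
  refine Measure.integrableOn_of_bounded (M := 1) (volume_square_lt_top L).ne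
    (by fun_prop) (ae_of_all _ fun y => ?_)
  have := mul_nonneg (hg.surv_nonneg c y) (hg.surv_nonneg x y)
  have := mul_le_one₀ (hg.surv_le_one c y) (hg.surv_nonneg x y) (hg.surv_le_one x y)
  rw [Real.norm_eq_abs, abs_le]
  constructor <;> linarith

lemma hit_nonneg (hg : IsConnection g) {m n : ℕ} (c : Fin m → Plane) (x : Fin n → Plane)
    (L : ℝ) : 0 ≤ hit g L c x := by
  refine integral_nonneg fun y => ?_
  have := mul_le_one₀ (hg.surv_le_one c y) (hg.surv_nonneg x y) (hg.surv_le_one x y)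
  simp only [Pi.zero_apply]
  linarith

lemma measurable_hit (hg : IsConnection g) {m : ℕ} (c : Fin m → Plane) (n : ℕ) (L : ℝ) :
    Measurable fun x : Fin n → Plane => hit g L c x := by
  have h1 := hg.measurable_surv_right c
  have h2 := hg.measurable_surv n
  have : Measurable fun p : (Fin n → Plane) × Plane => 1 - surv g c p.2 * surv g p.1 p.2 := by
    fun_prop
  exact this.stronglyMeasurable.integral_prod_right.measurable

lemma measurable_weight (hg : IsConnection g) {m : ℕ} (c : Fin m → Plane) (n : ℕ) (lam L : ℝ) :
    Measurable fun x : Fin n → Plane => weight g lam L c x := by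
  have := hg.measurable_hit c n L
  unfold weight
  fun_prop

end IsConnection

lemma surv_cons (g : ℝ → ℝ) {m : ℕ} (b : Plane) (c : Fin m → Plane) (y : Plane) :
    surv g (Fin.cons b c) y = (1 - g ‖y - b‖) * surv g c y := by
  simp [surv, Fin.prod_univ_succ]

lemma surv_insertNth (g : ℝ → ℝ) {n : ℕ} (i : Fin (n + 1)) (b : Plane) (x : Fin n → Plane)
    (y : Plane) : surv g (i.insertNth b x) y = (1 - g ‖y - b‖) * surv g x y := by
  simp [surv, Fin.prod_univ_succAbove _ i]

lemma surv_zero (g : ℝ → ℝ) (c : Fin 0 → Plane) (y : Plane) : surv g c y = 1 := by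
  simp [surv]

lemma hit_insertNth (g : ℝ → ℝ) (L : ℝ) {m n : ℕ} (c : Fin m → Plane) (i : Fin (n + 1))
    (b : Plane) (x : Fin n → Plane) :
    hit g L c (i.insertNth b x) = hit g L (Fin.cons b c : Fin (m + 1) → Plane) x := by
  unfold hit
  congr 1; ext y
  rw [surv_insertNth, surv_cons]; ring

lemma weight_insertNth (g : ℝ → ℝ) (lam L : ℝ) {m n : ℕ} (c : Fin m → Plane) (i : Fin (n + 1))
    (b : Plane) (x : Fin n → Plane) :
    weight g lam L c (i.insertNth b x) =
      weight g lam L (Fin.cons b c : Fin (m + 1) → Plane) x := by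
  rw [weight, hit_insertNth, weight]

lemma weight_le_weight {g : ℝ → ℝ} {lam L : ℝ} (hlam : 0 ≤ lam) {m n m' n' : ℕ}
    {c : Fin m → Plane} {x : Fin n → Plane} {c' : Fin m' → Plane} {x' : Fin n' → Plane}
    (h : hit g L c' x' ≤ hit g L c x) : weight g lam L c x ≤ weight g lam L c' x' := by
  unfold weight
  gcongr

lemma weight_cons_le {g : ℝ → ℝ} (hg : IsConnection g) {lam : ℝ} (hlam : 0 ≤ lam) (L : ℝ)
    {m n : ℕ} (b : Plane) (c : Fin m → Plane) (x : Fin n → Plane) :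
    weight g lam L (Fin.cons b c : Fin (m + 1) → Plane) x ≤ weight g lam L c x := by
  refine weight_le_weight hlam ?_
  refine setIntegral_mono (hg.integrableOn_hit _ _ _) (hg.integrableOn_hit _ _ _) fun y => ?_
  simp only [surv_cons]
  have := mul_nonneg (hg.surv_nonneg c y) (hg.surv_nonneg x y)
  have := hg.nonneg ‖y - b‖
  nlinarith

/-- Integrating over configurations one of whose points lies in `B`. -/
lemma lintegral_indicator_weight {g : ℝ → ℝ} (hg : IsConnection g) (lam L : ℝ) {m n : ℕ}
    (c : Fin m → Plane) (i : Fin (n + 1)) {B : Set Plane} (hB : MeasurableSet B) :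
    ∫⁻ x : Fin (n + 1) → Plane, B.indicator 1 (x i) * weight g lam L c x
        ∂(Measure.pi fun _ => intensity lam L) =
      ∫⁻ b in B, partFun g lam L (Fin.cons b c : Fin (m + 1) → Plane) n ∂(intensity lam L) := by
  have hmp := (measurePreserving_piFinSuccAbove (fun _ : Fin (n + 1) => intensity lam L) i).symm
  have hmw := hg.measurable_weight c (n + 1) lam L
  have hmi : Measurable (B.indicator (1 : Plane → ENNReal)) := measurable_one.indicator hB
  have hmeas : Measurable fun x : Fin (n + 1) → Plane =>
      B.indicator 1 (x i) * weight g lam L c x := by fun_prop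
  rw [← hmp.lintegral_comp hmeas, lintegral_prod _ (by
    exact (hmeas.comp hmp.measurable).aemeasurable), ← lintegral_indicator hB]
  refine lintegral_congr fun b => ?_
  have key : ∀ y : Fin n → Plane,
      (MeasurableEquiv.piFinSuccAbove (fun _ : Fin (n + 1) => Plane) i).symm (b, y) =
        i.insertNth b y := fun _ => rfl
  simp only [key, Fin.insertNth_apply_same, weight_insertNth]
  by_cases hb : b ∈ B <;> simp [hb, partFun]

lemma partFun_zero (g : ℝ → ℝ) (lam L : ℝ) {m : ℕ} (c : Fin m → Plane) :
    partFun g lam L c 0 = weight g lam L c ![] := by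
  unfold partFun
  rw [Measure.pi_of_empty _ ![]]
  simp

lemma partFun_succ {g : ℝ → ℝ} (hg : IsConnection g) (lam L : ℝ) {m : ℕ} (c : Fin m → Plane)
    (n : ℕ) : partFun g lam L c (n + 1) =
      ∫⁻ b, partFun g lam L (Fin.cons b c : Fin (m + 1) → Plane) n ∂(intensity lam L) := by
  simpa [partFun] using lintegral_indicator_weight hg lam L c (0 : Fin (n + 1)) .univ

lemma partFun_cons_le {g : ℝ → ℝ} (hg : IsConnection g) {lam : ℝ} (hlam : 0 ≤ lam) (L : ℝ)
    {m : ℕ} (b : Plane) (c : Fin m → Plane) (n : ℕ) :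
    partFun g lam L (Fin.cons b c : Fin (m + 1) → Plane) n ≤ partFun g lam L c n :=
  lintegral_mono fun _ => weight_cons_le hg hlam L b c _

lemma measurable_partFun_cons {g : ℝ → ℝ} (hg : IsConnection g) (lam L : ℝ) {m : ℕ}
    (c : Fin m → Plane) (n : ℕ) :
    Measurable fun b => partFun g lam L (Fin.cons b c : Fin (m + 1) → Plane) n := by
  have hmp := (measurePreserving_piFinSuccAbove
    (fun _ : Fin (n + 1) => intensity lam L) 0).symm
  have := ((hg.measurable_weight c (n + 1) lam L).comp hmp.measurable).lintegral_prod_right'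
    (ν := Measure.pi fun _ : Fin n => intensity lam L)
  convert this using 2 with b
  exact lintegral_congr fun x => (weight_insertNth g lam L c 0 b x).symm

namespace IsConnection

variable {g : ℝ → ℝ}

lemma integrable_shift (hg : IsConnection g) (a : Plane) :
    Integrable (fun y : Plane => g ‖y - a‖) :=
  hg.int.comp_sub_right a

lemma setIntegral_shift_le (hg : IsConnection g) (a : Plane) (s : Set Plane) :
    ∫ y in s, g ‖y - a‖ ≤ Cg g := by
  refine (setIntegral_le_integral (hg.integrable_shift a)
    (ae_of_all _ fun y => hg.nonneg _)).trans_eq ?_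
  exact integral_sub_right_eq_self (fun y : Plane => g ‖y‖) a

/-- Two groups of points at mutual distance at least `R` are hit almost independently. -/
lemma hit_add_hit_le (hg : IsConnection g) (L : ℝ) {m n : ℕ} {c : Fin m → Plane}
    {x : Fin n → Plane} {R : ℝ} (h : ∀ j i, R ≤ dist (x i) (c j)) :
    hit g L c ![] + hit g L ![] x ≤ hit g L c x + m * n * (2 * Cg g * g (R / 2)) := by
  have hmul : ∀ j i y, g ‖y - c j‖ * g ‖y - x i‖ ≤
      g (R / 2) * (g ‖y - c j‖ + g ‖y - x i‖) := by
    intro j i y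
    have h1 := hg.nonneg ‖y - c j‖
    have h2 := hg.nonneg ‖y - x i‖
    have h3 := hg.nonneg (R / 2)
    have hd : R ≤ ‖y - c j‖ + ‖y - x i‖ := by
      refine (h j i).trans ((dist_triangle_left _ _ y).trans ?_)
      rw [dist_eq_norm, dist_eq_norm, add_comm]
    rcases le_total (R / 2) ‖y - c j‖ with h' | h'
    · nlinarith [hg.anti h']
    · nlinarith [hg.anti (show R / 2 ≤ ‖y - x i‖ by linarith)]
  have hint1 : ∀ j i, IntegrableOn (fun y => g (R / 2) * (g ‖y - c j‖ + g ‖y - x i‖))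
      (square L) := fun j i =>
    (((hg.integrable_shift (c j)).add (hg.integrable_shift (x i))).const_mul _).integrableOn
  have hint2 : ∀ j, IntegrableOn (fun y => ∑ i, g (R / 2) * (g ‖y - c j‖ + g ‖y - x i‖))
      (square L) := fun j => integrable_finsetSum _ fun i _ => hint1 j i
  have hint3 : IntegrableOn (fun y => ∑ j, ∑ i, g (R / 2) * (g ‖y - c j‖ + g ‖y - x i‖))
      (square L) := integrable_finsetSum _ fun j _ => hint2 j
  have hbound : ∫ y in square L, ∑ j, ∑ i, g (R / 2) * (g ‖y - c j‖ + g ‖y - x i‖) ≤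
      m * n * (2 * Cg g * g (R / 2)) := by
    rw [integral_finsetSum _ fun j _ => hint2 j]
    have : ∀ j, ∫ y in square L, ∑ i, g (R / 2) * (g ‖y - c j‖ + g ‖y - x i‖) ≤
        n * (2 * Cg g * g (R / 2)) := by
      intro j
      rw [integral_finsetSum _ fun i _ => hint1 j i]
      have : ∀ i, ∫ y in square L, g (R / 2) * (g ‖y - c j‖ + g ‖y - x i‖) ≤
          2 * Cg g * g (R / 2) := by
        intro i
        rw [integral_const_mul, integral_add (hg.integrable_shift _).integrableOn
          (hg.integrable_shift _).integrableOn]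
        nlinarith [hg.nonneg (R / 2), hg.setIntegral_shift_le (c j) (square L),
          hg.setIntegral_shift_le (x i) (square L)]
      exact (Finset.sum_le_sum fun i _ => this i).trans_eq (by simp)
    exact (Finset.sum_le_sum fun j _ => this j).trans_eq (by simp [mul_assoc])
  refine le_trans ?_ (add_le_add_right hbound _)
  unfold hit
  rw [← integral_add (hg.integrableOn_hit _ _ _) (hg.integrableOn_hit _ _ _),
    ← integral_add (hg.integrableOn_hit _ _ _) hint3]
  refine setIntegral_mono ((hg.integrableOn_hit _ _ _).add (hg.integrableOn_hit _ _ _))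
    ((hg.integrableOn_hit _ _ _).add hint3) fun y => ?_
  have hsum : (1 - surv g c y) * (1 - surv g x y) ≤
      ∑ j, ∑ i, g (R / 2) * (g ‖y - c j‖ + g ‖y - x i‖) := by
    calc (1 - surv g c y) * (1 - surv g x y)
        ≤ (∑ j, g ‖y - c j‖) * ∑ i, g ‖y - x i‖ :=
          mul_le_mul (hg.one_sub_surv_le c y) (hg.one_sub_surv_le x y)
            (by linarith [hg.surv_le_one x y]) (Finset.sum_nonneg fun j _ => hg.nonneg _)
      _ = ∑ j, ∑ i, g ‖y - c j‖ * g ‖y - x i‖ := Finset.sum_mul_sum _ _ _ _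
      _ ≤ _ := Finset.sum_le_sum fun j _ => Finset.sum_le_sum fun i _ => hmul j i y
  simp only [surv_zero]
  linarith

end IsConnection

/-- The neighbourhood of radius `R` of a finite configuration. -/
def nearSet {m : ℕ} (c : Fin m → Plane) (R : ℝ) : Set Plane := ⋃ j, Metric.ball (c j) R

lemma measurableSet_nearSet {m : ℕ} (c : Fin m → Plane) (R : ℝ) :
    MeasurableSet (nearSet c R) :=
  MeasurableSet.iUnion fun _ => measurableSet_ball

lemma intensity_ball_le {lam : ℝ} (L : ℝ) (a : Plane) (R : ℝ) :
    intensity lam L (Metric.ball a R) ≤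
      ENNReal.ofReal lam * (ENNReal.ofReal R ^ 2 * ENNReal.ofReal π) := by
  rw [intensity, Measure.smul_apply, smul_eq_mul, ← EuclideanSpace.volume_ball_fin_two]
  gcongr
  exact Measure.restrict_le_self

lemma intensity_nearSet_le {lam : ℝ} (L : ℝ) {m : ℕ} (c : Fin m → Plane) (R : ℝ) :
    intensity lam L (nearSet c R) ≤
      m * (ENNReal.ofReal lam * (ENNReal.ofReal R ^ 2 * ENNReal.ofReal π)) := by
  refine (measure_iUnion_fintype_le _ _).trans ?_
  exact (Finset.sum_le_sum fun j _ => intensity_ball_le L (c j) R).trans_eq (by simp)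

/-- Decomposition according to whether some point is near the points `c`. -/
lemma partFun_le_add {g : ℝ → ℝ} (hg : IsConnection g) {lam : ℝ} (hlam : 0 ≤ lam) (L : ℝ)
    {m : ℕ} (c : Fin m → Plane) (n : ℕ) {R K : ℝ}
    (hK : lam * (m * (n + 1 : ℕ) * (2 * Cg g * g (R / 2))) ≤ K) :
    partFun g lam L c (n + 1) ≤
      ENNReal.ofReal (Real.exp K) * weight g lam L c ![] * partFun g lam L ![] (n + 1) +
      (n + 1 : ℕ) * ∫⁻ b in nearSet c R,
        partFun g lam L (Fin.cons b c : Fin (m + 1) → Plane) n ∂(intensity lam L) := by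
  have hB := measurableSet_nearSet c R
  have hmi : Measurable ((nearSet c R).indicator (1 : Plane → ENNReal)) :=
    measurable_one.indicator hB
  have hw := hg.measurable_weight c (n + 1) lam L
  have hsum : (n + 1 : ℕ) * ∫⁻ b in nearSet c R,
        partFun g lam L (Fin.cons b c : Fin (m + 1) → Plane) n ∂(intensity lam L) =
      ∫⁻ x : Fin (n + 1) → Plane, ∑ i, (nearSet c R).indicator 1 (x i) * weight g lam L c x
        ∂(Measure.pi fun _ => intensity lam L) := by
    rw [lintegral_finsetSum _ fun i _ => by fun_prop]
    simp [lintegral_indicator_weight hg lam L c _ hB]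
  rw [hsum, partFun, partFun, ← lintegral_const_mul' _ _ (by
    exact ENNReal.mul_ne_top ENNReal.ofReal_ne_top ENNReal.ofReal_ne_top),
    ← lintegral_add_right _ (by fun_prop)]
  refine lintegral_mono fun x => ?_
  by_cases hx : ∃ i, x i ∈ nearSet c R
  · obtain ⟨i, hi⟩ := hx
    refine le_add_left ?_
    refine le_trans ?_ (Finset.single_le_sum (f := fun i =>
      (nearSet c R).indicator 1 (x i) * weight g lam L c x) (fun _ _ => zero_le)
      (Finset.mem_univ i))
    simp [hi]
  · refine le_add_right ?_
    push Not at hx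
    have h : ∀ j i, R ≤ dist (x i) (c j) := by
      intro j i
      by_contra! hlt
      exact hx i (Set.mem_iUnion.2 ⟨j, hlt⟩)
    have := hg.hit_add_hit_le L h
    rw [weight, weight, weight, ← ENNReal.ofReal_mul (by positivity),
      ← ENNReal.ofReal_mul (by positivity), ← Real.exp_add, ← Real.exp_add]
    gcongr
    nlinarith [mul_le_mul_of_nonneg_left this hlam]

/-- Bound for the total weight of `n` points given `c`, when every point near `c` contributes
at most a factor `N`. -/
lemma partFun_le_of_bound {g : ℝ → ℝ} (hg : IsConnection g) {lam : ℝ} (hlam : 0 ≤ lam) (L : ℝ)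
    {m : ℕ} (c : Fin m → Plane) {R K : ℝ} {N M : ENNReal} (hN : 1 ≤ N) (hM : 1 ≤ M)
    (hnear : intensity lam L (nearSet c R) ≤ N) (n : ℕ)
    (hK : lam * (m * n * (2 * Cg g * g (R / 2))) ≤ K) (hC : 0 ≤ Cg g)
    (hpart : ∀ j ≤ n, partFun g lam L ![] j ≤ M) :
    partFun g lam L c n ≤
      (n + 1).factorial * (1 + ENNReal.ofReal (Real.exp K)) * N ^ n * M * weight g lam L c ![] := by
  induction n with
  | zero =>
    rw [partFun_zero]
    refine le_mul_of_one_le_left' ?_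
    simp only [zero_add, Nat.factorial_one, Nat.cast_one, one_mul, pow_zero, mul_one]
    exact one_le_mul le_self_add hM
  | succ n ih =>
    have hK' : lam * (m * n * (2 * Cg g * g (R / 2))) ≤ K := by
      refine le_trans ?_ hK
      have := hg.nonneg (R / 2)
      gcongr
      simp
    have ih := ih hK' fun j hj => hpart j (by omega)
    set e := ENNReal.ofReal (Real.exp K)
    set w := weight g lam L c ![]
    have h1 : ∫⁻ b in nearSet c R,
        partFun g lam L (Fin.cons b c : Fin (m + 1) → Plane) n ∂(intensity lam L) ≤
        N * ((n + 1).factorial * (1 + e) * N ^ n * M * w) := by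
      calc _ ≤ ∫⁻ b in nearSet c R, partFun g lam L c n ∂(intensity lam L) :=
            lintegral_mono fun b => partFun_cons_le hg hlam L b c n
        _ = intensity lam L (nearSet c R) * partFun g lam L c n := by
            rw [setLIntegral_const, mul_comm]
        _ ≤ _ := by gcongr
    have hA : (1 : ENNReal) ≤ N ^ (n + 1) := one_le_pow₀ hN
    have hF : (1 : ENNReal) ≤ (n + 1).factorial := by exact_mod_cast Nat.factorial_pos (n + 1)
    calc partFun g lam L c (n + 1)
        ≤ e * w * partFun g lam L ![] (n + 1) + (n + 1 : ℕ) * _ := partFun_le_add hg hlam L c n hK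
      _ ≤ e * w * M + (n + 1 : ℕ) * (N * ((n + 1).factorial * (1 + e) * N ^ n * M * w)) := by
          gcongr
          exact hpart _ le_rfl
      _ ≤ (n + 1).factorial * (1 + e) * N ^ (n + 1) * M * w +
          (n + 1 : ℕ) * (N * ((n + 1).factorial * (1 + e) * N ^ n * M * w)) := by
          refine add_le_add_left ?_ _
          calc e * w * M = 1 * e * 1 * M * w := by ring
            _ ≤ _ := by gcongr; exact le_add_self
      _ = _ := by
          rw [Nat.factorial_succ (n + 1)]
          push_cast
          ring

lemma ae_mem_square (lam L : ℝ) : ∀ᵐ a ∂(intensity lam L), a ∈ square L :=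
  Measure.ae_smul_measure (ae_restrict_mem (measurableSet_square L)) _

/-- Recursive bound for the total weight, peeling off one point. The hypothesis `hpair` says that
two points at distance between `ε` and `R` weigh at most a factor `γ` times a single point. -/
lemma partFun_add_two_le {g : ℝ → ℝ} (hg : IsConnection g) {lam : ℝ} (hlam : 0 ≤ lam) {L : ℝ}
    (n : ℕ) {R ε K : ℝ} {N M N₀ γ : ENNReal} (hN : 1 ≤ N) (hM : 1 ≤ M)
    (hnear : ∀ {m : ℕ} (c : Fin m → Plane), m ≤ 2 → intensity lam L (nearSet c R) ≤ N)
    (hball : ∀ a, intensity lam L (Metric.ball a ε) ≤ N₀)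
    (hK : lam * (2 * (n + 1 : ℕ) * (2 * Cg g * g (R / 2))) ≤ K) (hC : 0 ≤ Cg g)
    (hpart : ∀ j ≤ n, partFun g lam L ![] j ≤ M)
    (hpair : ∀ a ∈ square L, ∀ b ∈ square L, ε ≤ dist b a → dist b a < R →
      weight g lam L ![b, a] ![] ≤ γ * (weight g lam L ![a] ![] + weight g lam L ![b] ![])) :
    partFun g lam L ![] (n + 2) ≤
      ENNReal.ofReal (Real.exp K) * partFun g lam L ![] 1 * partFun g lam L ![] (n + 1) +
      (n + 1 : ℕ) * (N₀ * partFun g lam L ![] (n + 1) +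
        (n + 1).factorial * (1 + ENNReal.ofReal (Real.exp K)) * N ^ n * M * γ *
          (2 * N * partFun g lam L ![] 1)) := by
  set e := ENNReal.ofReal (Real.exp K) with he
  set ν := intensity lam L with hν
  set D := (n + 1).factorial * (1 + e) * N ^ n * M with hD
  have hK1 : lam * ((1 : ℕ) * (n + 1 : ℕ) * (2 * Cg g * g (R / 2))) ≤ K := by
    refine le_trans ?_ hK
    have := hg.nonneg (R / 2)
    gcongr
    norm_num
  have hK2 : lam * ((2 : ℕ) * n * (2 * Cg g * g (R / 2))) ≤ K := by
    refine le_trans ?_ hK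
    have := hg.nonneg (R / 2)
    gcongr <;> simp
  have hwm : Measurable fun a : Plane => weight g lam L ![a] ![] := by
    have := measurable_partFun_cons hg lam L ![] 0
    simp only [partFun_zero] at this
    exact this
  have hw1 : ∫⁻ a, weight g lam L ![a] ![] ∂ν = partFun g lam L ![] 1 := by
    rw [partFun_succ hg]
    simp only [partFun_zero]
    rfl
  have hone : ∫⁻ a, partFun g lam L ![a] n ∂ν = partFun g lam L ![] (n + 1) :=
    (partFun_succ hg lam L ![] n).symm
  have hmone : Measurable fun a => partFun g lam L ![a] n :=
    measurable_partFun_cons hg lam L ![] n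
  have hbd : ∀ᵐ a ∂ν, partFun g lam L ![a] (n + 1) ≤
      e * weight g lam L ![a] ![] * partFun g lam L ![] (n + 1) +
      (n + 1 : ℕ) * (N₀ * partFun g lam L ![a] n +
        D * γ * ∫⁻ b in Metric.ball a R,
          (weight g lam L ![a] ![] + weight g lam L ![b] ![]) ∂ν) := by
    filter_upwards [ae_mem_square lam L] with a ha
    refine (partFun_le_add hg hlam L ![a] n (R := R) hK1).trans ?_
    refine add_le_add_right (mul_le_mul_right ?_ _) _
    have hsub : nearSet ![a] R ⊆ Metric.ball a ε ∪ (Metric.ball a R \ Metric.ball a ε) := by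
      intro b hb
      simp only [nearSet, Set.mem_iUnion] at hb
      obtain ⟨j, hj⟩ := hb
      fin_cases j
      rw [Set.union_sdiff_self]
      exact Or.inr hj
    refine (lintegral_mono_set hsub).trans ((lintegral_union_le _ _ _).trans ?_)
    refine add_le_add ?_ ?_
    · calc _ ≤ ∫⁻ b in Metric.ball a ε, partFun g lam L ![a] n ∂ν :=
            lintegral_mono fun b => partFun_cons_le hg hlam L b ![a] n
        _ = ν (Metric.ball a ε) * partFun g lam L ![a] n := by
            rw [setLIntegral_const, mul_comm]
        _ ≤ _ := by gcongr; exact hball a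
    · rw [← lintegral_const_mul _ (by fun_prop)]
      refine le_trans (lintegral_mono_ae (g := fun b => D * γ * (weight g lam L ![a] ![] +
        weight g lam L ![b] ![])) ?_) (lintegral_mono_set Set.sdiff_subset)
      have h1 : ∀ᵐ b ∂ν.restrict (Metric.ball a R \ Metric.ball a ε), b ∈ square L :=
        ae_restrict_of_ae (ae_mem_square lam L)
      filter_upwards [h1, ae_restrict_mem (measurableSet_ball.diff measurableSet_ball)] with b hb hb'
      have h2 := hpair a ha b hb (by simpa using hb'.2) hb'.1
      calc partFun g lam L (Fin.cons b ![a] : Fin 2 → Plane) n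
          ≤ D * weight g lam L (Fin.cons b ![a] : Fin 2 → Plane) ![] :=
            partFun_le_of_bound hg hlam L _ hN hM (hnear _ le_rfl) n hK2 hC hpart
        _ ≤ D * (γ * (weight g lam L ![a] ![] + weight g lam L ![b] ![])) :=
            mul_le_mul_right h2 _
        _ = _ := by ring
  have hset : MeasurableSet {p : Plane × Plane | dist p.2 p.1 < R} :=
    measurableSet_lt (by fun_prop) measurable_const
  have hdouble : ∫⁻ a, ∫⁻ b in Metric.ball a R,
      (weight g lam L ![a] ![] + weight g lam L ![b] ![]) ∂ν ∂ν ≤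
      2 * N * partFun g lam L ![] 1 := by
    have hballN : ∀ a, ν (Metric.ball a R) ≤ N := by
      intro a
      refine le_trans (measure_mono ?_) (hnear ![a] (by norm_num))
      exact Set.subset_iUnion_of_subset 0 (by simp)
    have hA : ∫⁻ a, ∫⁻ b in Metric.ball a R, weight g lam L ![a] ![] ∂ν ∂ν ≤
        N * partFun g lam L ![] 1 := by
      rw [← hw1, ← lintegral_const_mul _ hwm]
      refine lintegral_mono fun a => ?_
      dsimp only
      rw [setLIntegral_const, mul_comm]
      gcongr
      exact hballN a
    have hB : ∫⁻ a, ∫⁻ b in Metric.ball a R, weight g lam L ![b] ![] ∂ν ∂ν ≤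
        N * partFun g lam L ![] 1 := by
      have hm : Measurable fun p : Plane × Plane =>
          {p : Plane × Plane | dist p.2 p.1 < R}.indicator
            (fun p => weight g lam L ![p.2] ![]) p :=
        (hwm.comp measurable_snd).indicator hset
      calc _ = ∫⁻ a, ∫⁻ b, {p : Plane × Plane | dist p.2 p.1 < R}.indicator
            (fun p => weight g lam L ![p.2] ![]) (a, b) ∂ν ∂ν := by
            refine lintegral_congr fun a => ?_
            rw [← lintegral_indicator measurableSet_ball]
            rfl
        _ = ∫⁻ b, ∫⁻ a, {p : Plane × Plane | dist p.2 p.1 < R}.indicator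
            (fun p => weight g lam L ![p.2] ![]) (a, b) ∂ν ∂ν :=
            lintegral_lintegral_swap hm.aemeasurable
        _ = ∫⁻ b, ∫⁻ a in Metric.ball b R, weight g lam L ![b] ![] ∂ν ∂ν := by
            refine lintegral_congr fun b => ?_
            rw [← lintegral_indicator measurableSet_ball]
            refine lintegral_congr fun a => ?_
            simp [Set.indicator, dist_comm]
        _ ≤ _ := hA
    calc _ = ∫⁻ a, (∫⁻ b in Metric.ball a R, weight g lam L ![a] ![] ∂ν +
          ∫⁻ b in Metric.ball a R, weight g lam L ![b] ![] ∂ν) ∂ν :=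
          lintegral_congr fun a => lintegral_add_left measurable_const _
      _ = ∫⁻ a, ∫⁻ b in Metric.ball a R, weight g lam L ![a] ![] ∂ν ∂ν +
          ∫⁻ a, ∫⁻ b in Metric.ball a R, weight g lam L ![b] ![] ∂ν ∂ν := by
          refine lintegral_add_left ?_ _
          have hm : Measurable fun p : Plane × Plane =>
              {p : Plane × Plane | dist p.2 p.1 < R}.indicator
                (fun p => weight g lam L ![p.1] ![]) p :=
            (hwm.comp measurable_fst).indicator hset
          have := hm.lintegral_prod_right' (ν := ν)
          convert this using 2 with a
          rw [← lintegral_indicator measurableSet_ball]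
          rfl
      _ ≤ N * partFun g lam L ![] 1 + N * partFun g lam L ![] 1 := add_le_add hA hB
      _ = _ := by ring
  calc partFun g lam L ![] (n + 2) = ∫⁻ a, partFun g lam L ![a] (n + 1) ∂ν :=
        partFun_succ hg lam L ![] (n + 1)
    _ ≤ _ := lintegral_mono_ae hbd
    _ = e * partFun g lam L ![] 1 * partFun g lam L ![] (n + 1) +
        (n + 1 : ℕ) * (N₀ * partFun g lam L ![] (n + 1) +
        D * γ * ∫⁻ a, ∫⁻ b in Metric.ball a R,
          (weight g lam L ![a] ![] + weight g lam L ![b] ![]) ∂ν ∂ν) := by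
        have h1 : Measurable fun a =>
            e * weight g lam L ![a] ![] * partFun g lam L ![] (n + 1) := by fun_prop
        have hm : Measurable fun p : Plane × Plane =>
            {p : Plane × Plane | dist p.2 p.1 < R}.indicator
              (fun p => weight g lam L ![p.1] ![] + weight g lam L ![p.2] ![]) p :=
          ((hwm.comp measurable_fst).add (hwm.comp measurable_snd)).indicator hset
        have h2 : Measurable fun a => ∫⁻ b in Metric.ball a R,
            (weight g lam L ![a] ![] + weight g lam L ![b] ![]) ∂ν := by
          have := hm.lintegral_prod_right' (ν := ν)
          convert this using 2 with a
          rw [← lintegral_indicator measurableSet_ball]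
          rfl
        rw [lintegral_add_left h1, lintegral_const_mul' _ _ (by simp),
          lintegral_add_left (by fun_prop), lintegral_const_mul _ hmone,
          lintegral_const_mul _ h2, lintegral_mul_const _ (by fun_prop),
          lintegral_const_mul _ hwm, hw1, hone]
    _ ≤ _ := by gcongr

lemma norm_add_single_le_norm_add {i : Fin 2} {z v : Plane} {τ : ℝ} (hz : 0 ≤ z i)
    (hzj : ∀ j ≠ i, |z j| ≤ z i / 2) (hvj : ∀ j, |v j| ≤ v i) (hτ : 0 ≤ τ) (hτv : τ ≤ v i / 2) :
    ‖z + EuclideanSpace.single i τ‖ ≤ ‖z + v‖ := by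
  have key : ∀ p q x y : ℝ, 0 ≤ p → |q| ≤ p / 2 → |y| ≤ x → τ ≤ x / 2 →
      (p + τ) ^ 2 + q ^ 2 ≤ (p + x) ^ 2 + (q + y) ^ 2 := by
    intro p q x y hp hq hy hx
    have hqy : |q * y| ≤ p / 2 * x := by
      rw [abs_mul]; exact mul_le_mul hq hy (abs_nonneg _) (by positivity)
    have := neg_abs_le (q * y)
    nlinarith [mul_nonneg hp hτ, mul_le_mul_of_nonneg_left hx hp, sq_nonneg y,
      mul_le_mul hx hx hτ (by linarith), sq_nonneg x]
  rw [EuclideanSpace.norm_eq, EuclideanSpace.norm_eq]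
  apply Real.sqrt_le_sqrt
  fin_cases i
  · simpa [Fin.sum_univ_two] using key (z 0) (z 1) (v 0) (v 1) hz (hzj 1 (by simp)) (hvj 1) hτv
  · have := key (z 1) (z 0) (v 1) (v 0) hz (hzj 0 (by simp)) (hvj 0) hτv
    simp only [Fin.sum_univ_two]
    simp
    linarith

/-- The rectangle `[s, t) × [0, h]`, the first factor being the coordinate `i`. -/
def rect (i : Fin 2) (s t h : ℝ) : Set Plane :=
  {z | z i ∈ Set.Ico s t ∧ ∀ j ≠ i, z j ∈ Set.Icc 0 h}

lemma rect_eq_preimage (i : Fin 2) (s t h : ℝ) :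
    rect i s t h = (WithLp.ofLp : Plane → (Fin 2 → ℝ)) ⁻¹'
      (Set.univ.pi fun j => if j = i then Set.Ico s t else Set.Icc 0 h) := by
  ext x
  fin_cases i <;> simp [rect, Fin.forall_fin_two, and_comm]

lemma measurableSet_pi_rect (i : Fin 2) (s t h : ℝ) :
    MeasurableSet (Set.univ.pi fun j : Fin 2 => if j = i then Set.Ico s t else Set.Icc 0 h) := by
  refine MeasurableSet.univ_pi fun j => ?_
  split_ifs
  exacts [measurableSet_Ico, measurableSet_Icc]

lemma measurableSet_rect (i : Fin 2) (s t h : ℝ) : MeasurableSet (rect i s t h) := by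
  rw [rect_eq_preimage]
  exact (PiLp.volume_preserving_ofLp (Fin 2)).measurable (measurableSet_pi_rect i s t h)

lemma volume_rect (i : Fin 2) (s t h : ℝ) :
    volume (rect i s t h) = ENNReal.ofReal (t - s) * ENNReal.ofReal h := by
  rw [rect_eq_preimage, (PiLp.volume_preserving_ofLp (Fin 2)).measure_preimage
    (measurableSet_pi_rect i s t h).nullMeasurableSet, volume_pi_pi]
  fin_cases i <;> simp [Fin.prod_univ_two, mul_comm]

lemma volumeReal_rect (i : Fin 2) {s t h : ℝ} (hst : s ≤ t) (hh : 0 ≤ h) :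
    volume.real (rect i s t h) = (t - s) * h := by
  rw [Measure.real, volume_rect, ENNReal.toReal_mul, ENNReal.toReal_ofReal (by linarith),
    ENNReal.toReal_ofReal hh]

lemma abs_coord_le_norm (z : Plane) (i : Fin 2) : |z i| ≤ ‖z‖ := by
  simpa using PiLp.norm_apply_le z i

lemma norm_le_abs_add_abs (z : Plane) : ‖z‖ ≤ |z 0| + |z 1| := by
  rw [EuclideanSpace.norm_eq, Real.sqrt_le_left (by positivity), Fin.sum_univ_two]
  simp only [Real.norm_eq_abs]
  nlinarith [abs_nonneg (z 0), abs_nonneg (z 1)]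

namespace IsConnection

variable {g : ℝ → ℝ}

lemma integrable_rect_add (hg : IsConnection g) (i : Fin 2) {s t u h : ℝ} (hst : s ≤ t)
    (htu : t ≤ u) :
    (∫ z in rect i s t h, g ‖z‖) + (∫ z in rect i t u h, g ‖z‖) = ∫ z in rect i s u h, g ‖z‖ := by
  rw [← setIntegral_union ?_ (measurableSet_rect i t u h)
    hg.int.integrableOn hg.int.integrableOn]
  · congr 2
    ext z
    simp only [rect, Set.mem_union, Set.mem_ofPred_eq, ← or_and_right, Set.mem_Ico]
    refine and_congr_left fun _ => ?_
    constructor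
    · rintro (h | h) <;> constructor <;> linarith
    · intro h
      rcases lt_or_ge (z i) t with h' | h'
      exacts [Or.inl ⟨h.1, h'⟩, Or.inr ⟨h', h.2⟩]
  · rw [Set.disjoint_left]
    rintro z ⟨h1, -⟩ ⟨h2, -⟩
    exact absurd h1.2 (not_lt.2 h2.1)

lemma setIntegral_rect_shift (i : Fin 2) (s t h τ : ℝ) :
    ∫ z in rect i s t h, g ‖z + EuclideanSpace.single i τ‖ =
      ∫ z in rect i (s + τ) (t + τ) h, g ‖z‖ := by
  have hmp := measurePreserving_add_right (volume : Measure Plane) (EuclideanSpace.single i τ)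
  rw [← hmp.setIntegral_preimage_emb (measurableEmbedding_addRight _) (fun z => g ‖z‖)
    (rect i (s + τ) (t + τ) h)]
  congr 2
  ext z
  simp only [rect, Set.mem_preimage, Set.mem_ofPred_eq, PiLp.add_apply]
  refine and_congr (by simp) (forall₂_congr fun j hj => ?_)
  simp [hj]

/-- Moving away from a rectangle decreases the integral of the connection function by an amount
which is linear in the displacement. -/
lemma le_setIntegral_rect (hg : IsConnection g) {i : Fin 2} {η r τ : ℝ} (hη : 0 < η)
    (hr : η ≤ r) {v : Plane} (hvj : ∀ j, |v j| ≤ v i) (hτ : 0 ≤ τ) (hτv : τ ≤ v i / 2)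
    (hτη : τ ≤ η) :
    (g (3 * η) - g r) * (τ * (η / 2)) ≤
      ∫ z in rect i η r (η / 2), g ‖z‖ * (1 - g ‖z + v‖) := by
  have hgm := hg.measurable
  have hshift : Integrable fun z : Plane => g ‖z + EuclideanSpace.single i τ‖ :=
    hg.int.comp_add_right _
  have hprod : Integrable fun z : Plane => g ‖z‖ * (1 - g ‖z + v‖) := by
    refine hg.int.mono' (by fun_prop) (ae_of_all _ fun z => ?_)
    have h1 := hg.nonneg ‖z‖
    have h2 := hg.nonneg ‖z + v‖
    have h3 := hg.le_one ‖z + v‖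
    rw [Real.norm_of_nonneg (mul_nonneg h1 (by linarith))]
    nlinarith
  have hmono : ∫ z in rect i η r (η / 2), (g ‖z‖ - g ‖z + EuclideanSpace.single i τ‖) ≤
      ∫ z in rect i η r (η / 2), g ‖z‖ * (1 - g ‖z + v‖) := by
    refine setIntegral_mono_on (hg.int.sub hshift).integrableOn hprod.integrableOn
      (measurableSet_rect _ _ _ _) fun z hz => ?_
    have hzi : η ≤ z i := hz.1.1
    have hle : ‖z + EuclideanSpace.single i τ‖ ≤ ‖z + v‖ := by
      refine norm_add_single_le_norm_add (by linarith) (fun j hj => ?_) hvj hτ hτv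
      have := hz.2 j hj
      rw [abs_of_nonneg this.1]
      linarith [this.2]
    have h1 := hg.anti hle
    have h2 := hg.nonneg ‖z + v‖
    have h3 := hg.le_one ‖z‖
    nlinarith
  refine le_trans ?_ hmono
  rw [integral_sub hg.int.integrableOn hshift.integrableOn, setIntegral_rect_shift]
  have e1 := hg.integrable_rect_add i hr (show r ≤ r + τ by linarith) (h := η / 2)
  have e2 := hg.integrable_rect_add i (show η ≤ η + τ by linarith)
    (show η + τ ≤ r + τ by linarith) (h := η / 2)
  have hlow : g (3 * η) * (τ * (η / 2)) ≤ ∫ z in rect i η (η + τ) (η / 2), g ‖z‖ := by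
    have := volumeReal_rect i (show η ≤ η + τ by linarith) (show 0 ≤ η / 2 by linarith)
    rw [add_sub_cancel_left] at this
    rw [← this, mul_comm, ← smul_eq_mul, ← setIntegral_const]
    refine setIntegral_mono_on (integrableOn_const (by
      rw [volume_rect]; exact ENNReal.mul_ne_top ENNReal.ofReal_ne_top ENNReal.ofReal_ne_top))
      hg.int.integrableOn (measurableSet_rect _ _ _ _) fun z hz => hg.anti ?_
    have hz1 : |z i| ≤ 2 * η := by
      rw [abs_of_nonneg (hη.le.trans hz.1.1)]; linarith [hz.1.2]
    have hz2 : ∀ j ≠ i, |z j| ≤ η := by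
      intro j hj
      rw [abs_of_nonneg (hz.2 j hj).1]; linarith [(hz.2 j hj).2]
    refine (norm_le_abs_add_abs z).trans ?_
    fin_cases i
    · linarith [hz2 1 (by simp), show |z 0| ≤ 2 * η from hz1]
    · linarith [hz2 0 (by simp), show |z 1| ≤ 2 * η from hz1]
  have hup : ∫ z in rect i r (r + τ) (η / 2), g ‖z‖ ≤ g r * (τ * (η / 2)) := by
    have := volumeReal_rect i (show r ≤ r + τ by linarith) (show 0 ≤ η / 2 by linarith)
    rw [add_sub_cancel_left] at this
    rw [← this, mul_comm, ← smul_eq_mul, ← setIntegral_const]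
    refine setIntegral_mono_on hg.int.integrableOn (integrableOn_const (by
      rw [volume_rect]; exact ENNReal.mul_ne_top ENNReal.ofReal_ne_top ENNReal.ofReal_ne_top))
      (measurableSet_rect _ _ _ _) fun z hz => hg.anti ?_
    exact hz.1.1.trans ((le_abs_self _).trans (abs_coord_le_norm z i))
  linarith

lemma hit_pair_eq (hg : IsConnection g) (L : ℝ) (a b : Plane) :
    hit g L ![b, a] ![] =
      hit g L ![a] ![] + ∫ y in square L, g ‖y - b‖ * (1 - g ‖y - a‖) := by
  have h1 := hg.integrableOn_hit ![b, a] ![] L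
  have h2 := hg.integrableOn_hit ![a] ![] L
  have h3 := h1.sub h2
  have h4 : ∫ y in square L, g ‖y - b‖ * (1 - g ‖y - a‖) =
      hit g L ![b, a] ![] - hit g L ![a] ![] := by
    rw [hit, hit, ← integral_sub h1 h2]
    congr 1; ext y
    simp [surv]; ring
  linarith

lemma hit_pair_comm (L : ℝ) (a b : Plane) : hit g L ![b, a] ![] = hit g L ![a, b] ![] := by
  unfold hit
  congr 1; ext y
  simp [surv, mul_comm]

/-- Gain from a second point `b`, when a suitably oriented rectangle at `b` lies in the square. -/
lemma add_le_hit_pair (hg : IsConnection g) {L : ℝ} {i : Fin 2} {η r τ : ℝ} (hη : 0 < η)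
    (hr : η ≤ r) (hL : 2 * r ≤ L) {a b : Plane} (hb : b ∈ square L)
    {s : ℝ} (hs : s = 1 ∨ s = -1) (hsb : s * b i ≤ L / 2)
    (hvj : ∀ j, |b j - a j| ≤ s * (b i - a i)) (hτ : 0 ≤ τ) (hτv : τ ≤ s * (b i - a i) / 2)
    (hτη : τ ≤ η) :
    hit g L ![a] ![] + (g (3 * η) - g r) * (τ * (η / 2)) ≤ hit g L ![b, a] ![] := by
  rw [hg.hit_pair_eq]
  refine add_le_add_right ?_ _
  obtain ⟨σ, hσ, hσi, hσb⟩ : ∃ σ : Fin 2 → ℝ, (∀ j, σ j = 1 ∨ σ j = -1) ∧ σ i = s ∧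
      ∀ j ≠ i, σ j * b j ≤ 0 := by
    refine ⟨fun j => if j = i then s else if b j ≤ 0 then 1 else -1, fun j => ?_, by simp,
      fun j hj => ?_⟩
    · dsimp only
      split_ifs <;> simp [hs]
    · simp only [hj, if_false]
      split_ifs <;> linarith
  have hσσ : ∀ j, σ j * σ j = 1 := fun j => by rcases hσ j with h | h <;> simp [h]
  let Φ : Plane ≃ₗᵢ[ℝ] Plane := LinearIsometryEquiv.piLpCongrRight 2 fun j =>
    if σ j = 1 then LinearIsometryEquiv.refl ℝ ℝ else LinearIsometryEquiv.neg ℝ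
  have hΦ : ∀ z j, Φ z j = σ j * z j := by
    intro z j
    change (if σ j = 1 then LinearIsometryEquiv.refl ℝ ℝ else LinearIsometryEquiv.neg ℝ) (z j) = _
    rcases hσ j with h | h
    · simp [h]
    · simp [h, show (-1 : ℝ) ≠ 1 by norm_num]
  have hΦΦ : ∀ z, Φ (Φ z) = z := by
    intro z
    ext j
    rw [hΦ, hΦ, ← mul_assoc, hσσ, one_mul]
  have hmp : MeasurePreserving (fun z => b + Φ z) :=
    (measurePreserving_add_left volume b).comp Φ.measurePreserving
  have hemb : MeasurableEmbedding (fun z => b + Φ z) :=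
    (measurableEmbedding_addLeft b).comp Φ.toHomeomorph.measurableEmbedding
  rw [← hmp.setIntegral_preimage_emb hemb]
  have hnorm : ∀ z, ‖b + Φ z - a‖ = ‖z + Φ (b - a)‖ := by
    intro z
    rw [← Φ.norm_map (z + Φ (b - a)), map_add, hΦΦ]
    congr 1; abel
  simp only [add_sub_cancel_left, LinearIsometryEquiv.norm_map, hnorm]
  refine (hg.le_setIntegral_rect (i := i) (v := Φ (b - a)) hη hr ?_ hτ ?_ hτη).trans ?_
  · intro j
    rw [hΦ, hΦ, hσi]
    simp only [PiLp.sub_apply]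
    refine le_trans (le_of_eq ?_) (hvj j)
    rcases hσ j with h | h
    · simp [h]
    · rw [h, abs_mul]; simp
  · rw [hΦ, hσi]
    simpa using hτv
  · have hgm := hg.measurable
    refine setIntegral_mono_set ?_ (ae_of_all _ fun z => ?_) (LE.le.eventuallyLE ?_)
    · refine Integrable.integrableOn (hg.int.mono' (by fun_prop) (ae_of_all _ fun z => ?_))
      have h1 := hg.nonneg ‖z‖
      have h2 := hg.nonneg ‖z + Φ (b - a)‖
      have h3 := hg.le_one ‖z + Φ (b - a)‖
      rw [Real.norm_of_nonneg (mul_nonneg h1 (by linarith))]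
      nlinarith
    · exact mul_nonneg (hg.nonneg _) (by linarith [hg.le_one ‖z + Φ (b - a)‖])
    · intro z hz j
      rw [PiLp.add_apply, hΦ]
      have hbj := hb j
      by_cases hj : j = i
      · subst hj
        have h1 := hz.1.1
        have h2 := hz.1.2
        rw [hσi]
        rcases hs with h | h <;> subst h <;> constructor <;> linarith [hbj.1, hbj.2]
      · have h1 := hz.2 j hj
        have h2 := hσb j hj
        rcases hσ j with h | h <;> rw [h] at h2 ⊢ <;> constructor <;>
          linarith [hbj.1, hbj.2, h1.1, h1.2]

/-- Two points at distance `d` are hit more often than one of them, by an amount linear in `d`. -/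
lemma min_add_le_hit_pair (hg : IsConnection g) {L η r : ℝ} (hη : 0 < η) (hr : η ≤ r)
    (hgr : g r ≤ g (3 * η)) (hL : 2 * r ≤ L) {a b : Plane} (ha : a ∈ square L) (hb : b ∈ square L)
    (hd : dist b a ≤ L) :
    min (hit g L ![a] ![]) (hit g L ![b] ![]) +
      (g (3 * η) - g r) * (min (dist b a / 4) η * (η / 2)) ≤ hit g L ![b, a] ![] := by
  obtain ⟨i, hi⟩ : ∃ i, ∀ j, |b j - a j| ≤ |b i - a i| := Finite.exists_max _
  wlog hab : a i ≤ b i generalizing a b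
  · have := this hb ha (by rwa [dist_comm]) (fun j => by
      rw [abs_sub_comm, abs_sub_comm (a i)]; exact hi j) (le_of_not_ge hab)
    rw [min_comm, dist_comm, hit_pair_comm]
    exact this
  set τ := min (dist b a / 4) η with hτdef
  have hτ : 0 ≤ τ := le_min (by positivity) hη.le
  have hτη : τ ≤ η := min_le_right _ _
  have hdist : dist b a ≤ 2 * (b i - a i) := by
    rw [dist_eq_norm]
    refine (norm_le_abs_add_abs _).trans ?_
    have h0 := hi 0
    have h1 := hi 1
    rw [abs_of_nonneg (sub_nonneg.2 hab)] at h0 h1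
    simp only [PiLp.sub_apply]
    linarith
  have hτv : τ ≤ (b i - a i) / 2 := (min_le_left _ _).trans (by linarith)
  have hi' : ∀ j, |b j - a j| ≤ b i - a i := by
    intro j; rw [← abs_of_nonneg (sub_nonneg.2 hab)]; exact hi j
  have hgain : 0 ≤ (g (3 * η) - g r) * (τ * (η / 2)) :=
    mul_nonneg (by linarith) (by positivity)
  rcases le_total (b i) (L / 2) with hbL | hbL
  · refine le_trans (add_le_add_left (min_le_left _ _) _) ?_
    exact hg.add_le_hit_pair (i := i) (s := 1) hη hr hL hb (Or.inl rfl) (by linarith)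
      (fun j => by linarith [hi' j]) hτ (by linarith) hτη
  · refine le_trans (add_le_add_left (min_le_right _ _) _) ?_
    rw [hit_pair_comm]
    have h1 : b i - a i ≤ L := by
      refine (le_abs_self _).trans (le_trans ?_ hd)
      rw [dist_eq_norm]
      exact abs_coord_le_norm (b - a) i
    exact hg.add_le_hit_pair (i := i) (s := -1) hη hr hL ha (Or.inr rfl) (by linarith)
      (fun j => by rw [abs_sub_comm]; linarith [hi' j]) hτ (by linarith) hτη

end IsConnection

/-- The integral of the connection function over the half plane `{z | s < z i}`. -/
noncomputable def halfTail (g : ℝ → ℝ) (i : Fin 2) (s : ℝ) : ℝ :=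
  ∫ z : Plane in {z | s < z i}, g ‖z‖

lemma measurableSet_halfPlane (i : Fin 2) (s : ℝ) : MeasurableSet {z : Plane | s < z i} :=
  measurableSet_lt measurable_const (by fun_prop)

namespace IsConnection

variable {g : ℝ → ℝ}

lemma halfTail_nonneg (hg : IsConnection g) (i : Fin 2) (s : ℝ) : 0 ≤ halfTail g i s :=
  integral_nonneg fun _ => hg.nonneg _

lemma halfTail_antitone (hg : IsConnection g) (i : Fin 2) : Antitone (halfTail g i) :=
  fun _ _ hst => setIntegral_mono_set hg.int.integrableOn (ae_of_all _ fun _ => hg.nonneg _)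
    (LE.le.eventuallyLE fun _ hz => lt_of_le_of_lt hst hz)

lemma setIntegral_right_eq (i : Fin 2) (L : ℝ) (a : Plane) :
    ∫ y : Plane in {y | L < y i}, g ‖y - a‖ = halfTail g i (L - a i) := by
  have hmp := measurePreserving_sub_right (volume : Measure Plane) a
  rw [halfTail, ← hmp.setIntegral_preimage_emb (measurableEmbedding_subRight a)
    (fun z => g ‖z‖)]
  congr 2
  ext z
  simp

lemma setIntegral_left_eq (i : Fin 2) (L : ℝ) (a : Plane) :
    ∫ y : Plane in {y | y i < -L}, g ‖y - a‖ = halfTail g i (L + a i) := by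
  have hmp := Measure.measurePreserving_sub_left (volume : Measure Plane) a
  rw [halfTail, ← hmp.setIntegral_preimage_emb
    (Homeomorph.subLeft a).measurableEmbedding (fun z => g ‖z‖)]
  simp only [norm_sub_rev a]
  congr 2
  ext z
  simp only [Set.mem_preimage, Set.mem_ofPred_eq, PiLp.sub_apply]
  constructor <;> intro h <;> linarith

lemma hit_single_eq (L : ℝ) (a : Plane) :
    hit g L ![a] ![] = ∫ y in square L, g ‖y - a‖ := by
  unfold hit
  congr 1; ext y
  simp [surv]

/-- The mass hit by a single point, up to four half-plane tails. -/
lemma le_hit_single (hg : IsConnection g) (L : ℝ) (a : Plane) :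
    Cg g ≤ hit g L ![a] ![] +
      ∑ i, (halfTail g i (L - a i) + halfTail g i (L + a i)) := by
  have hI := hg.integrable_shift a
  have hC : ∫ y : Plane, g ‖y - a‖ = Cg g :=
    integral_sub_right_eq_self (fun y : Plane => g ‖y‖) a
  rw [← hC, ← integral_add_compl (measurableSet_square L) hI, hit_single_eq]
  refine add_le_add_right ?_ _
  have hm1 : ∀ i : Fin 2, MeasurableSet {y : Plane | L < y i} :=
    fun i => measurableSet_halfPlane i L
  have hm2 : ∀ i : Fin 2, MeasurableSet {y : Plane | y i < -L} :=
    fun i => measurableSet_lt (by fun_prop) measurable_const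
  have hi1 : ∀ i : Fin 2, Integrable ({y : Plane | L < y i}.indicator fun y => g ‖y - a‖) :=
    fun i => hI.indicator (hm1 i)
  have hi2 : ∀ i : Fin 2, Integrable ({y : Plane | y i < -L}.indicator fun y => g ‖y - a‖) :=
    fun i => hI.indicator (hm2 i)
  have hi : ∀ i : Fin 2, Integrable fun y : Plane =>
      {y : Plane | L < y i}.indicator (fun y => g ‖y - a‖) y +
      {y : Plane | y i < -L}.indicator (fun y => g ‖y - a‖) y := fun i => (hi1 i).add (hi2 i)
  have hsum : ∑ i, (halfTail g i (L - a i) + halfTail g i (L + a i)) =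
      ∫ y : Plane, ∑ i, ({y : Plane | L < y i}.indicator (fun y => g ‖y - a‖) y +
        {y : Plane | y i < -L}.indicator (fun y => g ‖y - a‖) y) := by
    rw [integral_finsetSum _ fun i _ => hi i]
    refine Finset.sum_congr rfl fun i _ => ?_
    rw [integral_add (hi1 i) (hi2 i), integral_indicator (hm1 i), integral_indicator (hm2 i),
      setIntegral_right_eq, setIntegral_left_eq]
  rw [hsum, ← integral_indicator (measurableSet_square L).compl]
  refine integral_mono (hI.indicator (measurableSet_square L).compl)
    (integrable_finsetSum _ fun i _ => hi i) fun y => ?_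
  have h0 : ∀ (s : Set Plane), 0 ≤ s.indicator (fun y => g ‖y - a‖) y :=
    fun s => Set.indicator_nonneg (fun _ _ => hg.nonneg _) _
  by_cases hy : y ∈ square L
  · rw [Set.indicator_of_notMem (by simpa using hy)]
    exact Finset.sum_nonneg fun i _ => add_nonneg (h0 _) (h0 _)
  · rw [Set.indicator_of_mem (by simpa using hy)]
    simp only [square, Set.mem_ofPred_eq, not_forall] at hy
    obtain ⟨i, hi⟩ := hy
    refine le_trans ?_ (Finset.single_le_sum (f := fun i =>
      {y : Plane | L < y i}.indicator (fun y => g ‖y - a‖) y +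
      {y : Plane | y i < -L}.indicator (fun y => g ‖y - a‖) y)
      (fun i _ => add_nonneg (h0 _) (h0 _)) (Finset.mem_univ i))
    rw [Set.mem_Icc, not_and_or, not_le, not_le] at hi
    rcases hi with hi | hi
    · have : y ∈ {y : Plane | y i < -L} := hi
      simp only [Set.indicator_of_mem this]
      linarith [h0 {y : Plane | L < y i}]
    · have : y ∈ {y : Plane | L < y i} := hi
      simp only [Set.indicator_of_mem this]
      linarith [h0 {y : Plane | y i < -L}]

/-- The half-plane tail decreases linearly near the origin. -/
lemma two_mul_halfTail_add_le (hg : IsConnection g) (i : Fin 2) {s η : ℝ} (hs : 0 ≤ s)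
    (hη : 0 < η) : 2 * halfTail g i s + g (2 * η) * η * min s η ≤ Cg g := by
  have hneg : ∫ z : Plane in {z | z i < -s}, g ‖z‖ = halfTail g i s := by
    simpa using setIntegral_left_eq (g := g) i s 0
  set P : Set Plane := {z | s < z i}
  set N : Set Plane := {z | z i < -s}
  have hP : MeasurableSet P := measurableSet_halfPlane i s
  have hN : MeasurableSet N := measurableSet_lt (by fun_prop) measurable_const
  have hQ := measurableSet_rect i 0 (min s η) η
  have hm : 0 ≤ min s η := le_min hs hη.le
  have hlow : g (2 * η) * η * min s η ≤ ∫ z in rect i 0 (min s η) η, g ‖z‖ := by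
    have := volumeReal_rect i hm hη.le
    rw [show g (2 * η) * η * min s η = ((min s η - 0) * η) * g (2 * η) by ring, ← this,
      ← smul_eq_mul, ← setIntegral_const]
    refine setIntegral_mono_on (integrableOn_const (by
      rw [volume_rect]; exact ENNReal.mul_ne_top ENNReal.ofReal_ne_top ENNReal.ofReal_ne_top))
      hg.int.integrableOn hQ fun z hz => hg.anti ?_
    have hz1 : |z i| ≤ η := by
      rw [abs_of_nonneg hz.1.1]; exact hz.1.2.le.trans (min_le_right _ _)
    have hz2 : ∀ j ≠ i, |z j| ≤ η := by
      intro j hj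
      rw [abs_of_nonneg (hz.2 j hj).1]; exact (hz.2 j hj).2
    refine (norm_le_abs_add_abs z).trans ?_
    have h0 : ∀ j, |z j| ≤ η := fun j => by
      by_cases h : j = i
      · rw [h]; exact hz1
      · exact hz2 j h
    linarith [h0 0, h0 1]
  have hd1 : Disjoint P N := by
    rw [Set.disjoint_left]
    intro z (h1 : s < z i) (h2 : z i < -s)
    linarith
  have hd2 : Disjoint (P ∪ N) (rect i 0 (min s η) η) := by
    rw [Set.disjoint_left]
    rintro z (h1 | h1) ⟨h2, -⟩
    · exact absurd (h2.2.trans_le (min_le_left _ _)) (not_lt.2 (le_of_lt h1))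
    · have h1' : z i < -s := h1
      linarith [h2.1]
  have hall : (∫ z in P ∪ N ∪ rect i 0 (min s η) η, g ‖z‖) ≤ Cg g :=
    setIntegral_le_integral hg.int (ae_of_all _ fun _ => hg.nonneg _)
  rw [setIntegral_union hd2 hQ hg.int.integrableOn hg.int.integrableOn,
    setIntegral_union hd1 hN hg.int.integrableOn hg.int.integrableOn, hneg] at hall
  have : (∫ z in P, g ‖z‖) = halfTail g i s := rfl
  linarith

/-- Logarithmic bound for the tail. -/
lemma halfTail_le_div_log (hg : IsConnection g) (i : Fin 2) {s : ℝ} (hs : 1 < s)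
    (hdec : ∀ x, s < x → g x ≤ 1 / (x ^ 2 * Real.log x ^ 2)) :
    halfTail g i s ≤ 2 * π / Real.log s := by
  have h1 : halfTail g i s ≤ ∫ z : Plane, (Set.Ioi s).indicator g ‖z‖ := by
    rw [halfTail, ← integral_indicator (measurableSet_halfPlane i s)]
    have hm : MeasurableSet {z : Plane | s < ‖z‖} := measurableSet_lt (by fun_prop) (by fun_prop)
    have hint : Integrable fun z : Plane => (Set.Ioi s).indicator g ‖z‖ :=
      hg.int.indicator hm
    refine integral_mono (hg.int.indicator (measurableSet_halfPlane i s)) hint fun z => ?_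
    by_cases hz : s < z i
    · have hz' : s < ‖z‖ := hz.trans_le ((le_abs_self _).trans (abs_coord_le_norm z i))
      simp [Set.indicator, hz, hz']
    · rw [Set.indicator_of_notMem (by simpa using hz)]
      exact Set.indicator_nonneg (fun _ _ => hg.nonneg _) _
  have hderiv : ∀ x ∈ Set.Ici s, HasDerivAt (fun x => -(Real.log x)⁻¹)
      (1 / (x * Real.log x ^ 2)) x := by
    intro x hx
    have hx1 : 1 < x := hs.trans_le hx
    have := ((Real.hasDerivAt_log (by linarith : x ≠ 0)).inv (Real.log_pos hx1).ne').neg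
    refine this.congr_deriv ?_
    field_simp
  have hpos : ∀ x ∈ Set.Ioi s, 0 ≤ 1 / (x * Real.log x ^ 2) := by
    intro x hx
    have : 0 < x := by linarith [show s < x from hx]
    positivity
  have hlim : Tendsto (fun x => -(Real.log x)⁻¹) atTop (nhds 0) := by
    simpa using (Real.tendsto_log_atTop.inv_tendsto_atTop).neg
  have hval := integral_Ioi_of_hasDerivAt_of_nonneg' hderiv hpos hlim
  have hint := integrableOn_Ioi_deriv_of_nonneg' hderiv hpos hlim
  refine h1.trans ?_
  rw [integral_fun_norm_addHaar]
  have hvol : volume.real (Metric.ball (0 : Plane) 1) = π := by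
    rw [Measure.real, EuclideanSpace.volume_ball_fin_two]
    simp [Real.pi_nonneg]
  rw [hvol]
  simp only [finrank_euclideanSpace, Fintype.card_fin, smul_eq_mul, nsmul_eq_mul]
  have h2 : ∫ y in Set.Ioi (0 : ℝ), y ^ (2 - 1) * (Set.Ioi s).indicator g y ≤ (Real.log s)⁻¹ := by
    calc ∫ y in Set.Ioi (0 : ℝ), y ^ (2 - 1) * (Set.Ioi s).indicator g y
        = ∫ y in Set.Ioi s, y * g y := by
          rw [← integral_indicator measurableSet_Ioi, ← integral_indicator measurableSet_Ioi]
          congr 1; ext y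
          by_cases hy : s < y
          · have : 0 < y := by linarith
            simp [hy, this]
          · simp [Set.indicator, hy]
      _ ≤ ∫ y in Set.Ioi s, 1 / (y * Real.log y ^ 2) := by
          refine integral_mono_of_nonneg ?_ hint ?_
          · filter_upwards [ae_restrict_mem measurableSet_Ioi] with y hy
            exact mul_nonneg (by linarith [show s < y from hy]) (hg.nonneg y)
          · filter_upwards [ae_restrict_mem measurableSet_Ioi] with y hy
            have hy' : s < y := hy
            have hy0 : 0 < y := by linarith
            refine (mul_le_mul_of_nonneg_left (hdec y hy') hy0.le).trans_eq ?_
            field_simp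
      _ = (Real.log s)⁻¹ := by rw [hval]; ring
  rw [div_eq_mul_inv]
  calc _ ≤ ((2 : ℕ) : ℝ) * (π * (Real.log s)⁻¹) := by gcongr
    _ = _ := by push_cast; ring

end IsConnection

lemma setLIntegral_square_mul (L : ℝ) {u₀ u₁ : ℝ → ENNReal} (h₀ : Measurable u₀)
    (h₁ : Measurable u₁) :
    ∫⁻ a in square L, u₀ (a 0) * u₁ (a 1) =
      (∫⁻ t in Set.Icc (-L) L, u₀ t) * ∫⁻ t in Set.Icc (-L) L, u₁ t := by
  have hmp := (volume_preserving_finTwoArrow ℝ).comp (PiLp.volume_preserving_ofLp (Fin 2))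
  rw [← lintegral_prod_mul h₀.aemeasurable h₁.aemeasurable, Measure.prod_restrict,
    ← Measure.volume_eq_prod,
    ← hmp.setLIntegral_comp_preimage (measurableSet_Icc.prod measurableSet_Icc)
      (by fun_prop : Measurable fun p : ℝ × ℝ => u₀ p.1 * u₁ p.2)]
  congr 2
  ext a
  simp [square, Fin.forall_fin_two, MeasurableEquiv.finTwoArrow]
  tauto

lemma setLIntegral_add_left_Icc (L : ℝ) (v : ℝ → ENNReal) :
    ∫⁻ t in Set.Icc (-L) L, v (L + t) = ∫⁻ s in Set.Icc 0 (2 * L), v s := by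
  have hmp := measurePreserving_add_left (volume : Measure ℝ) L
  rw [← hmp.setLIntegral_comp_preimage_emb (measurableEmbedding_addLeft L) v
    (Set.Icc 0 (2 * L))]
  congr 2
  ext t
  simp only [Set.mem_Icc, Set.mem_preimage]
  constructor <;> rintro ⟨h1, h2⟩ <;> constructor <;> linarith

lemma setLIntegral_sub_left_Icc (L : ℝ) (v : ℝ → ENNReal) :
    ∫⁻ t in Set.Icc (-L) L, v (L - t) = ∫⁻ s in Set.Icc 0 (2 * L), v s := by
  have hmp := Measure.measurePreserving_sub_left (volume : Measure ℝ) L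
  rw [← hmp.setLIntegral_comp_preimage_emb (Homeomorph.subLeft L).measurableEmbedding v
    (Set.Icc 0 (2 * L))]
  congr 2
  ext t
  simp only [Set.mem_Icc, Set.mem_preimage]
  constructor <;> rintro ⟨h1, h2⟩ <;> constructor <;> linarith

/-- Integral of the boundary correction factor over one coordinate. -/
lemma setLIntegral_exp_halfTail_le {g : ℝ → ℝ} (hg : IsConnection g) {lam L K : ℝ}
    (hlam : 0 ≤ lam) (i : Fin 2) (hK : lam * halfTail g i L ≤ K) :
    ∫⁻ t in Set.Icc (-L) L,
      ENNReal.ofReal (Real.exp (lam * (halfTail g i (L - t) + halfTail g i (L + t)))) ≤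
      ENNReal.ofReal (2 * Real.exp K) *
        ∫⁻ s in Set.Icc 0 (2 * L), ENNReal.ofReal (Real.exp (lam * halfTail g i s)) := by
  have hT := (hg.halfTail_antitone i).measurable
  set v : ℝ → ENNReal := fun s => ENNReal.ofReal (Real.exp (lam * halfTail g i s)) with hv
  have hvm : Measurable v := by fun_prop
  calc _ ≤ ∫⁻ t in Set.Icc (-L) L, ENNReal.ofReal (Real.exp K) * (v (L + t) + v (L - t)) := by
        refine lintegral_mono fun t => ?_
        dsimp only
        have key : ∀ p q : ℝ, L ≤ q →
            ENNReal.ofReal (Real.exp (lam * (halfTail g i p + halfTail g i q))) ≤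
              ENNReal.ofReal (Real.exp K) * v p := by
          intro p q hq
          rw [hv, ← ENNReal.ofReal_mul (by positivity), ← Real.exp_add]
          have := mul_le_mul_of_nonneg_left (hg.halfTail_antitone i hq) hlam
          gcongr
          linarith
        rcases le_total 0 t with ht | ht
        · refine (key (L - t) (L + t) (by linarith)).trans ?_
          gcongr
          exact le_add_self
        · rw [add_comm (halfTail g i (L - t))]
          refine (key (L + t) (L - t) (by linarith)).trans ?_
          gcongr
          exact le_self_add
    _ = _ := by
        rw [lintegral_const_mul' _ _ ENNReal.ofReal_ne_top, lintegral_add_left (by fun_prop),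
          setLIntegral_add_left_Icc, setLIntegral_sub_left_Icc,
          ENNReal.ofReal_mul (by norm_num), ENNReal.ofReal_ofNat]
        ring

/-- Piecewise bound for the integral of the boundary correction factor. -/
lemma setLIntegral_exp_halfTail_Icc_le {g : ℝ → ℝ} (hg : IsConnection g)
    {lam L K ε η W : ℝ} (hlam : 0 ≤ lam) (i : Fin 2) (hε : 0 ≤ ε) (hεη : ε ≤ η) (hη : 0 < η)
    (hW : 0 ≤ W) (hL : 0 ≤ L) (hK : lam * halfTail g i W ≤ K) :
    ∫⁻ s in Set.Icc 0 (2 * L), ENNReal.ofReal (Real.exp (lam * halfTail g i s)) ≤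
      ENNReal.ofReal (ε * Real.exp (lam * (Cg g / 2)) +
        η * Real.exp (lam * (Cg g / 2 - g (2 * η) * η * ε / 2)) +
        W * Real.exp (lam * (Cg g / 2 - g (2 * η) * η * η / 2)) + 2 * L * Real.exp K) := by
  have hsub : Set.Icc 0 (2 * L) ⊆
      ((Set.Icc 0 ε ∪ Set.Icc ε (ε + η)) ∪ Set.Icc η (η + W)) ∪ Set.Icc W (W + 2 * L) := by
    rintro s ⟨h1, h2⟩
    rcases le_or_gt s ε with h | h
    · exact Or.inl (Or.inl (Or.inl ⟨h1, h⟩))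
    rcases le_or_gt s η with h' | h'
    · exact Or.inl (Or.inl (Or.inr ⟨h.le, by linarith⟩))
    rcases le_or_gt s W with h'' | h''
    · exact Or.inl (Or.inr ⟨h'.le, by linarith⟩)
    · exact Or.inr ⟨h''.le, by linarith⟩
  have hpiece : ∀ p l B : ℝ, 0 ≤ l → lam * halfTail g i p ≤ B →
      ∫⁻ s in Set.Icc p (p + l), ENNReal.ofReal (Real.exp (lam * halfTail g i s)) ≤
        ENNReal.ofReal (l * Real.exp B) := by
    intro p l B hl hB
    calc _ ≤ ∫⁻ s in Set.Icc p (p + l), ENNReal.ofReal (Real.exp B) := by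
          refine setLIntegral_mono measurable_const fun s hs => ?_
          have := mul_le_mul_of_nonneg_left (hg.halfTail_antitone i hs.1) hlam
          exact ENNReal.ofReal_le_ofReal (Real.exp_le_exp.2 (this.trans hB))
      _ = _ := by
          rw [setLIntegral_const, Real.volume_Icc, add_sub_cancel_left, mul_comm,
            ENNReal.ofReal_mul hl]
  have hT : ∀ s, 0 ≤ s → halfTail g i s ≤ Cg g / 2 - g (2 * η) * η * min s η / 2 := by
    intro s hs
    linarith [hg.two_mul_halfTail_add_le i hs hη]
  have h0 : lam * halfTail g i 0 ≤ lam * (Cg g / 2) := by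
    refine mul_le_mul_of_nonneg_left ?_ hlam
    simpa [hη.le] using hT 0 le_rfl
  have h1 : lam * halfTail g i ε ≤ lam * (Cg g / 2 - g (2 * η) * η * ε / 2) := by
    refine mul_le_mul_of_nonneg_left ?_ hlam
    simpa [hεη] using hT ε hε
  have h2 : lam * halfTail g i η ≤ lam * (Cg g / 2 - g (2 * η) * η * η / 2) := by
    refine mul_le_mul_of_nonneg_left ?_ hlam
    simpa using hT η hη.le
  refine (lintegral_mono_set hsub).trans ?_
  rw [ENNReal.ofReal_add (by positivity) (by positivity),
    ENNReal.ofReal_add (by positivity) (by positivity),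
    ENNReal.ofReal_add (by positivity) (by positivity)]
  refine (lintegral_union_le _ _ _).trans (add_le_add ?_ (hpiece W (2 * L) K (by linarith) hK))
  refine (lintegral_union_le _ _ _).trans (add_le_add ?_ (hpiece η W _ hW h2))
  refine (lintegral_union_le _ _ _).trans (add_le_add ?_ (hpiece ε η _ hη.le h1))
  simpa using hpiece 0 ε _ hε h0

/-- The total weight of a single point, in terms of one-dimensional boundary integrals. -/
lemma partFun_one_le {g : ℝ → ℝ} (hg : IsConnection g) {lam L K J : ℝ}
    (hlam : 0 ≤ lam) (hK : ∀ i, lam * halfTail g i L ≤ K)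
    (hJ : ∀ i, ∫⁻ s in Set.Icc 0 (2 * L), ENNReal.ofReal (Real.exp (lam * halfTail g i s)) ≤
      ENNReal.ofReal J) (hJ0 : 0 ≤ J) :
    partFun g lam L ![] 1 ≤
      ENNReal.ofReal (lam * Real.exp (-(lam * Cg g)) * (2 * Real.exp K * J) ^ 2) := by
  set u : Fin 2 → ℝ → ENNReal := fun i t =>
    ENNReal.ofReal (Real.exp (lam * (halfTail g i (L - t) + halfTail g i (L + t)))) with hu
  have hum : ∀ i, Measurable (u i) := by
    intro i
    have := (hg.halfTail_antitone i).measurable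
    fun_prop
  have hui : ∀ i, ∫⁻ t in Set.Icc (-L) L, u i t ≤ ENNReal.ofReal (2 * Real.exp K * J) := by
    intro i
    refine (setLIntegral_exp_halfTail_le hg hlam i (hK i)).trans ?_
    rw [ENNReal.ofReal_mul (p := 2 * Real.exp K) (by positivity)]
    gcongr
    exact hJ i
  have hw : ∀ a, weight g lam L ![a] ![] ≤
      ENNReal.ofReal (Real.exp (-(lam * Cg g))) * (u 0 (a 0) * u 1 (a 1)) := by
    intro a
    rw [weight, hu, ← ENNReal.ofReal_mul (by positivity), ← ENNReal.ofReal_mul (by positivity),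
      ← Real.exp_add, ← Real.exp_add]
    have := mul_le_mul_of_nonneg_left (hg.le_hit_single L a) hlam
    rw [Fin.sum_univ_two] at this
    refine ENNReal.ofReal_le_ofReal (Real.exp_le_exp.2 ?_)
    linarith
  calc partFun g lam L ![] 1 = ∫⁻ a, weight g lam L ![a] ![] ∂(intensity lam L) := by
        rw [partFun_succ hg]
        simp only [partFun_zero]
        rfl
    _ ≤ ∫⁻ a, ENNReal.ofReal (Real.exp (-(lam * Cg g))) * (u 0 (a 0) * u 1 (a 1))
          ∂(intensity lam L) := lintegral_mono hw
    _ = ENNReal.ofReal lam * (ENNReal.ofReal (Real.exp (-(lam * Cg g))) *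
          ((∫⁻ t in Set.Icc (-L) L, u 0 t) * ∫⁻ t in Set.Icc (-L) L, u 1 t)) := by
        rw [intensity, lintegral_smul_measure, smul_eq_mul,
          lintegral_const_mul' _ _ ENNReal.ofReal_ne_top, setLIntegral_square_mul L (hum 0) (hum 1)]
    _ ≤ ENNReal.ofReal lam * (ENNReal.ofReal (Real.exp (-(lam * Cg g))) *
          (ENNReal.ofReal (2 * Real.exp K * J) * ENNReal.ofReal (2 * Real.exp K * J))) := by
        gcongr
        exacts [hui 0, hui 1]
    _ = _ := by
        rw [← ENNReal.ofReal_mul (by positivity), ← ENNReal.ofReal_mul (by positivity),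
          ← ENNReal.ofReal_mul (by positivity)]
        congr 1; ring

/-- Half the side of the observation square, as a function of `x = √λ`. -/
noncomputable def halfSide (g : ℝ → ℝ) (b x : ℝ) : ℝ := Real.exp ((x ^ 2 * Cg g - b) / 2) / (2 * x)

lemma pow_mul_exp_neg_le {c x : ℝ} (hc : 0 < c) (hx : 0 ≤ x) (m : ℕ) :
    x ^ m * Real.exp (-(c * x)) ≤ m.factorial / c ^ m := by
  have h := Real.pow_div_factorial_le_exp (c * x) (by positivity) m
  rw [div_le_iff₀ (by positivity), mul_pow] at h
  rw [Real.exp_neg, le_div_iff₀ (by positivity), ← div_eq_mul_inv, div_mul_eq_mul_div,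
    div_le_iff₀ (Real.exp_pos _)]
  linarith

lemma eventually_exp_le_halfSide {g : ℝ → ℝ} (hC : 0 < Cg g) (b : ℝ) :
    ∀ᶠ x : ℝ in atTop, Real.exp (Cg g / 4 * x ^ 2) ≤ halfSide g b x := by
  have h : Tendsto (fun x : ℝ => Real.exp (Cg g / 4 * x) / x ^ (1 : ℝ)) atTop atTop :=
    tendsto_exp_mul_div_rpow_atTop 1 _ (by positivity)
  filter_upwards [h.eventually_ge_atTop (2 * Real.exp (b / 2)), eventually_ge_atTop 1]
    with x hx hx1
  rw [Real.rpow_one, le_div_iff₀ (by positivity)] at hx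
  have h1 : Real.exp (Cg g / 4 * x) ≤ Real.exp (Cg g / 4 * x ^ 2) :=
    Real.exp_le_exp.2 (by gcongr; nlinarith)
  have h2 : Real.exp ((x ^ 2 * Cg g - b) / 2) * Real.exp (b / 2) =
      Real.exp (Cg g / 4 * x ^ 2) * Real.exp (Cg g / 4 * x ^ 2) := by
    rw [← Real.exp_add, ← Real.exp_add]; congr 1; ring
  rw [halfSide, le_div_iff₀ (by positivity)]
  refine le_of_mul_le_mul_right ?_ (Real.exp_pos (b / 2))
  rw [h2, mul_assoc]
  gcongr
  linarith

namespace IsConnection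

variable {g : ℝ → ℝ}

lemma exists_pos (hg : IsConnection g) (hC : 0 < Cg g) : ∃ η, 0 < η ∧ 0 < g (3 * η) := by
  by_contra! h
  refine hC.ne' ?_
  rw [Cg, integral_eq_zero_iff_of_nonneg (fun _ => hg.nonneg _) hg.int]
  filter_upwards [compl_mem_ae_iff.2 (measure_singleton (0 : Plane))] with z hz
  have hz0 : 0 < ‖z‖ := norm_pos_iff.2 (by simpa using hz)
  refine le_antisymm ?_ (hg.nonneg _)
  have := h (‖z‖ / 3) (by positivity)
  rwa [mul_div_cancel₀ _ (by norm_num)] at this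

lemma eventually_le_inv_sq (hdec : ∀ᶠ x in atTop, g x ≤ 1 / (x ^ 2 * Real.log x ^ 2)) :
    ∀ᶠ x in atTop, g x ≤ 1 / x ^ 2 := by
  filter_upwards [hdec, eventually_ge_atTop (Real.exp 1)] with x hx hx1
  have h0 : 0 < x := (Real.exp_pos 1).trans_le hx1
  have h1 : 1 ≤ Real.log x := (Real.le_log_iff_exp_le h0).2 hx1
  refine hx.trans (one_div_le_one_div_of_le (by positivity) ?_)
  nlinarith [sq_nonneg x, one_le_pow₀ h1 (n := 2)]

lemma exists_partFun_one_le (hg : IsConnection g) (hC : 0 < Cg g)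
    (hdec : ∀ᶠ x in atTop, g x ≤ 1 / (x ^ 2 * Real.log x ^ 2)) (b : ℝ) :
    ∃ M : ENNReal, M ≠ ⊤ ∧
      ∀ᶠ x : ℝ in atTop, partFun g (x ^ 2) (halfSide g b x) ![] 1 ≤ M := by
  obtain ⟨η, hη, hgη⟩ := hg.exists_pos hC
  have hg2 : 0 < g (2 * η) := hgη.trans_le (hg.anti (by linarith))
  set κ := g (2 * η) * η with hκ
  have hκ0 : 0 < κ := by positivity
  have hκC : κ * η ≤ Cg g := by
    have := hg.two_mul_halfTail_add_le 0 hη.le hη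
    rw [min_self] at this
    linarith [hg.halfTail_nonneg 0 η]
  set a := κ * η / 4 with ha
  have ha0 : 0 < a := by positivity
  set K := 2 * π / a with hKdef
  set B := 1 + η * (2 / κ) + 1 / a + Real.exp (-b / 2) * Real.exp K with hB
  refine ⟨ENNReal.ofReal ((2 * Real.exp K * B) ^ 2), ENNReal.ofReal_ne_top, ?_⟩
  obtain ⟨x₀, hx₀⟩ := eventually_atTop.1 hdec
  have hWtop : Tendsto (fun x : ℝ => Real.exp (a * x ^ 2)) atTop atTop :=
    Real.tendsto_exp_atTop.comp ((tendsto_pow_atTop two_ne_zero).const_mul_atTop ha0)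
  filter_upwards [hWtop.eventually_ge_atTop x₀, eventually_exp_le_halfSide hC b,
    eventually_ge_atTop 1, eventually_ge_atTop (1 / η)] with x hxW hxL hx1 hxη
  have hx0 : 0 < x := by linarith
  set W := Real.exp (a * x ^ 2) with hW
  set L := halfSide g b x with hL
  have hWL : W ≤ L := by
    refine le_trans (Real.exp_le_exp.2 ?_) hxL
    have : a ≤ Cg g / 4 := by linarith
    gcongr
  have hKW : ∀ i, x ^ 2 * halfTail g i W ≤ K := by
    intro i
    have hlog : Real.log W = a * x ^ 2 := Real.log_exp _
    have := hg.halfTail_le_div_log i (s := W) (Real.one_lt_exp_iff.2 (by positivity))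
      fun y hy => hx₀ y (hxW.trans hy.le)
    rw [hlog] at this
    calc x ^ 2 * halfTail g i W ≤ x ^ 2 * (2 * π / (a * x ^ 2)) := by gcongr
      _ = K := by rw [hKdef]; field_simp
  have hKL : ∀ i, x ^ 2 * halfTail g i L ≤ K := fun i =>
    (mul_le_mul_of_nonneg_left (hg.halfTail_antitone i hWL) (by positivity)).trans (hKW i)
  have hL0 : 0 ≤ L := (Real.exp_pos _).le.trans hWL
  have hεη : 1 / x ≤ η := by
    rw [div_le_iff₀ (by positivity)] at hxη ⊢
    linarith
  have hJ := fun i => setLIntegral_exp_halfTail_Icc_le hg (lam := x ^ 2) (by positivity) i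
    (ε := 1 / x) (by positivity) hεη hη (Real.exp_pos _).le hL0 (hKW i)
  refine (partFun_one_le hg (by positivity) hKL hJ (by positivity)).trans
    (ENNReal.ofReal_le_ofReal ?_)
  set E := Real.exp (x ^ 2 * Cg g / 2) with hE
  have hE0 : 0 < E := Real.exp_pos _
  have hE2 : Real.exp (-(x ^ 2 * Cg g)) = (E⁻¹) ^ 2 := by
    rw [hE, ← Real.exp_neg, ← Real.exp_nat_mul]; congr 1; push_cast; ring
  have e1 : Real.exp (x ^ 2 * (Cg g / 2)) = E := by rw [hE]; congr 1; ring
  have e2 : Real.exp (x ^ 2 * (Cg g / 2 - κ * (1 / x) / 2)) =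
      E * Real.exp (-(κ / 2 * x)) := by
    rw [hE, ← Real.exp_add]; congr 1; field_simp; ring
  have e3 : W * Real.exp (x ^ 2 * (Cg g / 2 - κ * η / 2)) = E * Real.exp (-(a * x ^ 2)) := by
    rw [hE, hW, ← Real.exp_add, ← Real.exp_add, ha]; congr 1; ring
  have e4 : 2 * L = E * Real.exp (-b / 2) / x := by
    rw [hL, halfSide, hE, ← Real.exp_add]
    have : (x ^ 2 * Cg g - b) / 2 = x ^ 2 * Cg g / 2 + -b / 2 := by ring
    rw [this]; field_simp
  rw [e1, e2, e3, e4, hE2]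
  have b1 : x * Real.exp (-(κ / 2 * x)) ≤ 2 / κ := by
    have := pow_mul_exp_neg_le (c := κ / 2) (by positivity) hx0.le 1
    simpa using this
  have b2 : x * Real.exp (-(a * x ^ 2)) ≤ 1 / a := by
    have := pow_mul_exp_neg_le ha0 (sq_nonneg x) 1
    rw [pow_one, pow_one, Nat.factorial_one, Nat.cast_one] at this
    refine le_trans ?_ this
    gcongr
    nlinarith
  have key : x * E⁻¹ * (1 / x * E + η * (E * Real.exp (-(κ / 2 * x))) +
      E * Real.exp (-(a * x ^ 2)) + E * Real.exp (-b / 2) / x * Real.exp K) ≤ B := by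
    have : x * E⁻¹ * (1 / x * E + η * (E * Real.exp (-(κ / 2 * x))) +
      E * Real.exp (-(a * x ^ 2)) + E * Real.exp (-b / 2) / x * Real.exp K) =
      1 + η * (x * Real.exp (-(κ / 2 * x))) + x * Real.exp (-(a * x ^ 2)) +
        Real.exp (-b / 2) * Real.exp K := by field_simp
    rw [this, hB]
    gcongr
  calc _ = (2 * Real.exp K * (x * E⁻¹ * (1 / x * E + η * (E * Real.exp (-(κ / 2 * x))) +
      E * Real.exp (-(a * x ^ 2)) + E * Real.exp (-b / 2) / x * Real.exp K))) ^ 2 := by ring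
    _ ≤ _ := by gcongr

lemma weight_pair_le (hg : IsConnection g) {lam L η r ε : ℝ} (hlam : 0 ≤ lam) (hη : 0 < η)
    (hr : η ≤ r) (hgr : g r ≤ g (3 * η)) (hL : 2 * r ≤ L) (hε : ε / 4 ≤ η) {a b : Plane}
    (ha : a ∈ square L) (hb : b ∈ square L) (hd : dist b a ≤ L) (hεd : ε ≤ dist b a) :
    weight g lam L ![b, a] ![] ≤
      ENNReal.ofReal (Real.exp (-(lam * ((g (3 * η) - g r) * (ε / 4 * (η / 2)))))) *
        (weight g lam L ![a] ![] + weight g lam L ![b] ![]) := by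
  have h := hg.min_add_le_hit_pair hη hr hgr hL ha hb hd
  have hmin : ε / 4 ≤ min (dist b a / 4) η := le_min (by linarith) hε
  have h' : min (hit g L ![a] ![]) (hit g L ![b] ![]) +
      (g (3 * η) - g r) * (ε / 4 * (η / 2)) ≤ hit g L ![b, a] ![] := by
    refine le_trans ?_ h
    have : 0 ≤ g (3 * η) - g r := by linarith
    gcongr
  have key : ∀ t, t + (g (3 * η) - g r) * (ε / 4 * (η / 2)) ≤ hit g L ![b, a] ![] →
      weight g lam L ![b, a] ![] ≤
        ENNReal.ofReal (Real.exp (-(lam * ((g (3 * η) - g r) * (ε / 4 * (η / 2)))))) *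
          ENNReal.ofReal (Real.exp (-(lam * t))) := by
    intro t ht
    rw [weight, ← ENNReal.ofReal_mul (Real.exp_pos _).le, ← Real.exp_add]
    refine ENNReal.ofReal_le_ofReal (Real.exp_le_exp.2 ?_)
    have := mul_le_mul_of_nonneg_left ht hlam
    linarith
  rcases min_choice (hit g L ![a] ![]) (hit g L ![b] ![]) with hm | hm <;> rw [hm] at h'
  · refine (key _ h').trans ?_
    gcongr
    exact le_self_add
  · refine (key _ h').trans ?_
    gcongr
    exact le_add_self

/-- The total weight of configurations of `n` points stays bounded. -/
lemma exists_partFun_le (hg : IsConnection g) (hC : 0 < Cg g)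
    (hdec : ∀ᶠ x in atTop, g x ≤ 1 / (x ^ 2 * Real.log x ^ 2)) (b : ℝ) (n : ℕ) :
    ∃ M : ENNReal, M ≠ ⊤ ∧
      ∀ᶠ x : ℝ in atTop, partFun g (x ^ 2) (halfSide g b x) ![] n ≤ M := by
  induction n using Nat.strong_induction_on with
  | _ n ih =>
  match n, ih with
  | 0, _ =>
    refine ⟨1, ENNReal.one_ne_top, Eventually.of_forall fun x => ?_⟩
    rw [partFun_zero, weight, ENNReal.ofReal_le_one, Real.exp_le_one_iff, neg_nonpos]
    exact mul_nonneg (sq_nonneg x) (hg.hit_nonneg _ _ _)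
  | 1, _ => exact hg.exists_partFun_one_le hC hdec b
  | n + 2, ih =>
    choose! A hAtop hA using ih
    obtain ⟨η, hη, hgη⟩ := hg.exists_pos hC
    obtain ⟨r, hr, hgr⟩ : ∃ r, η ≤ r ∧ g r < g (3 * η) := by
      have h0 : Tendsto (fun x : ℝ => 1 / x ^ 2) atTop (nhds 0) := by
        simp only [one_div]
        exact (tendsto_pow_atTop (α := ℝ) two_ne_zero).inv_tendsto_atTop
      obtain ⟨r, h1, h2, h3⟩ := ((eventually_le_inv_sq hdec).and
        ((h0.eventually_lt_const hgη).and (eventually_ge_atTop η))).exists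
      exact ⟨r, h3, h1.trans_lt h2⟩
    set c := (g (3 * η) - g r) * η / 8 with hc
    have hc0 : 0 < c := by
      have : 0 < g (3 * η) - g r := by linarith
      positivity
    set K : ℝ := 16 * (n + 1 : ℕ) * Cg g with hK
    set e := ENNReal.ofReal (Real.exp K) with he
    set M : ENNReal := 1 + ∑ j ∈ Finset.range (n + 1), A j with hM
    have hMtop : M ≠ ⊤ := by
      rw [hM, ENNReal.add_ne_top]
      refine ⟨ENNReal.one_ne_top, ENNReal.sum_ne_top.2 fun j hj => hAtop j ?_⟩
      have := Finset.mem_range.1 hj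
      omega
    set D : ENNReal := ENNReal.ofReal
      (2 * (2 * π) ^ (n + 1) * ((4 * (n + 1)).factorial / c ^ (4 * (n + 1)))) with hD
    refine ⟨e * A 1 * A (n + 1) + (n + 1 : ℕ) * (ENNReal.ofReal π * A (n + 1) +
      (n + 1).factorial * (1 + e) * M * D * A 1), ?_, ?_⟩
    · have h1 := hAtop 1 (by omega)
      have h2 := hAtop (n + 1) (by omega)
      finiteness
    have hall : ∀ᶠ x : ℝ in atTop, ∀ j ∈ Finset.range (n + 2),
        partFun g (x ^ 2) (halfSide g b x) ![] j ≤ A j :=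
      (Filter.eventually_all_finset _).2 fun j hj => hA j (Finset.mem_range.1 hj)
    have hLtop : Tendsto (fun x : ℝ => Real.exp (Cg g / 4 * x ^ 2)) atTop atTop :=
      Real.tendsto_exp_atTop.comp
        ((tendsto_pow_atTop two_ne_zero).const_mul_atTop (by positivity))
    have hhalf : Tendsto (fun x : ℝ => x / 2) atTop atTop :=
      tendsto_id.atTop_div_const (by norm_num)
    have hxL : ∀ᶠ x : ℝ in atTop, x ≤ Real.exp (Cg g / 4 * x ^ 2) := by
      filter_upwards [eventually_ge_atTop (4 / Cg g), eventually_ge_atTop 1] with x hx hx1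
      have h1 : 1 ≤ Cg g / 4 * x := by
        rw [div_le_iff₀ hC] at hx; linarith
      have := Real.add_one_le_exp (Cg g / 4 * x ^ 2)
      nlinarith
    filter_upwards [hall, hLtop.eventually_ge_atTop (2 * r), eventually_exp_le_halfSide hC b, hxL,
      hhalf.eventually (eventually_le_inv_sq hdec), eventually_ge_atTop 1,
      eventually_ge_atTop (1 / η)] with x hpart hrL hL hxL hgx hx1 hxη
    have hx0 : 0 < x := by linarith
    set L := halfSide g b x
    set N : ENNReal := ENNReal.ofReal (2 * π * x ^ 4) with hN
    set γ : ENNReal := ENNReal.ofReal (Real.exp (-(c * x))) with hγ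
    have hx4 : 1 ≤ x ^ 4 := one_le_pow₀ hx1
    have hstep := partFun_add_two_le hg (lam := x ^ 2) (sq_nonneg x) (L := L) n (R := x)
      (ε := 1 / x) (K := K) (N := N) (M := M) (N₀ := ENNReal.ofReal π) (γ := γ)
      (by
        rw [hN, ENNReal.one_le_ofReal]
        nlinarith [Real.pi_gt_three])
      (by rw [hM]; exact le_self_add)
      (by
        intro m q hm
        refine (intensity_nearSet_le L q x).trans ?_
        rw [← ENNReal.ofReal_pow hx0.le, ← ENNReal.ofReal_mul (by positivity),
          ← ENNReal.ofReal_mul (by positivity), ← ENNReal.ofReal_natCast,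
          ← ENNReal.ofReal_mul (by positivity)]
        refine ENNReal.ofReal_le_ofReal ?_
        have hm' : (m : ℝ) ≤ 2 := by exact_mod_cast hm
        calc (m : ℝ) * (x ^ 2 * (x ^ 2 * π)) ≤ 2 * (x ^ 2 * (x ^ 2 * π)) := by gcongr
          _ = _ := by ring)
      (by
        intro a
        refine (intensity_ball_le L a (1 / x)).trans_eq ?_
        rw [← ENNReal.ofReal_pow (by positivity), ← ENNReal.ofReal_mul (by positivity),
          ← ENNReal.ofReal_mul (by positivity)]
        congr 1
        field_simp)
      (by
        calc x ^ 2 * (2 * (n + 1 : ℕ) * (2 * Cg g * g (x / 2)))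
            ≤ x ^ 2 * (2 * (n + 1 : ℕ) * (2 * Cg g * (1 / (x / 2) ^ 2))) := by gcongr
          _ = K := by rw [hK]; field_simp; ring)
      hC.le
      (by
        intro j hj
        refine (hpart j (Finset.mem_range.2 (by omega))).trans ?_
        rw [hM]
        exact (Finset.single_le_sum (fun _ _ => zero_le) (Finset.mem_range.2 (by omega))).trans
          le_add_self)
      (by
        intro a ha d hd h1 h2
        have hεη : 1 / x / 4 ≤ η := by
          rw [div_le_iff₀ (by positivity)] at hxη
          rw [div_div, div_le_iff₀ (by positivity)]
          nlinarith
        refine (hg.weight_pair_le (sq_nonneg x) hη hr hgr.le (hrL.trans hL) hεη ha hd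
          (h2.le.trans (hxL.trans hL)) h1).trans_eq ?_
        rw [hγ, hc]
        congr 4
        field_simp
        ring)
    have hND : N ^ n * γ * (2 * N) ≤ D := by
      rw [hN, hγ, hD, ← ENNReal.ofReal_pow (by positivity), ← ENNReal.ofReal_mul (by positivity),
        ← ENNReal.ofReal_ofNat 2, ← ENNReal.ofReal_mul (by positivity),
        ← ENNReal.ofReal_mul (by positivity)]
      refine ENNReal.ofReal_le_ofReal ?_
      calc (2 * π * x ^ 4) ^ n * Real.exp (-(c * x)) * (2 * (2 * π * x ^ 4))
          = 2 * (2 * π) ^ (n + 1) * (x ^ (4 * (n + 1)) * Real.exp (-(c * x))) := by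
            rw [pow_mul x 4 (n + 1)]; ring
        _ ≤ _ := by
            gcongr
            exact pow_mul_exp_neg_le hc0 hx0.le _
    have h1 := hpart 1 (Finset.mem_range.2 (by omega))
    have h2 := hpart (n + 1) (Finset.mem_range.2 (by omega))
    refine hstep.trans ?_
    have hre : (n + 1).factorial * (1 + e) * N ^ n * M * γ *
        (2 * N * partFun g (x ^ 2) L ![] 1) =
        (n + 1).factorial * (1 + e) * M * (N ^ n * γ * (2 * N)) *
          partFun g (x ^ 2) L ![] 1 := by ring
    rw [← he, hre]
    gcongr

end IsConnection

lemma pi_const_smul {n : ℕ} (c : ENNReal) (hc : c ≠ ⊤) (μ : Measure Plane) [IsFiniteMeasure μ] :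
    (Measure.pi fun _ : Fin n => c • μ) = c ^ n • Measure.pi fun _ : Fin n => μ := by
  have : IsFiniteMeasure (c • μ) := Measure.smul_finite μ hc
  refine Measure.pi_eq fun s _ => ?_
  simp [Measure.smul_apply, Measure.pi_pi, Finset.prod_mul_distrib]

lemma sq_mul_sq_halfSide (g : ℝ → ℝ) (b : ℝ) {x : ℝ} (hx : 0 < x) :
    x ^ 2 * (2 * halfSide g b x) ^ 2 = Real.exp (x ^ 2 * Cg g - b) := by
  have h : Real.exp (x ^ 2 * Cg g - b) = Real.exp ((x ^ 2 * Cg g - b) / 2) ^ 2 := by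
    rw [← Real.exp_nat_mul]; congr 1; push_cast; ring
  rw [h, halfSide]
  field_simp

lemma halfSide_sqrt_lamDen {g : ℝ → ℝ} (hC : 0 < Cg g) {b ρ : ℝ} (hρ : 0 < ρ)
    (hb : 0 ≤ Real.log ρ + b) :
    halfSide g b (√(lamDen g b ρ)) = 1 / (2 * rRho g b ρ) := by
  have hlam : 0 ≤ lamDen g b ρ := div_nonneg hb hC.le
  have h1 : rRho g b ρ = √(lamDen g b ρ) / √ρ := by
    rw [rRho, ← div_div, ← lamDen, Real.sqrt_div hlam]
  have h2 : (lamDen g b ρ * Cg g - b) / 2 = Real.log ρ / 2 := by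
    rw [lamDen, div_mul_cancel₀ _ hC.ne']; ring
  have h3 : Real.exp (Real.log ρ / 2) = √ρ := by
    rw [Real.exp_half, Real.exp_log hρ]
  rw [halfSide, Real.sq_sqrt hlam, h2, h3, h1, mul_div_assoc', one_div_div]

namespace IsConnection

variable {g : ℝ → ℝ}

lemma exp_neg_le_partFun (hg : IsConnection g) (b : ℝ) (k : ℕ) {x : ℝ} (hx : 0 < x) :
    ENNReal.ofReal (Real.exp (-(k * b))) ≤ partFun g (x ^ 2) (halfSide g b x) ![] k := by
  set L := halfSide g b x with hL
  have hL0 : 0 ≤ L := by rw [hL, halfSide]; positivity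
  have hhit : ∀ z : Fin k → Plane, hit g L ![] z ≤ k * Cg g := by
    intro z
    have hI : ∀ i ∈ Finset.univ, IntegrableOn (fun y => g ‖y - z i‖) (square L) :=
      fun i _ => (hg.integrable_shift (z i)).integrableOn
    calc hit g L ![] z ≤ ∫ y in square L, ∑ i, g ‖y - z i‖ := by
          refine setIntegral_mono (hg.integrableOn_hit _ _ _) (integrable_finsetSum _ hI)
            fun y => ?_
          rw [surv_zero, one_mul]
          exact hg.one_sub_surv_le z y
      _ = ∑ i, ∫ y in square L, g ‖y - z i‖ := integral_finsetSum _ hI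
      _ ≤ ∑ _i : Fin k, Cg g := Finset.sum_le_sum fun i _ => hg.setIntegral_shift_le _ _
      _ = k * Cg g := by simp
  have huniv : intensity (x ^ 2) L Set.univ = ENNReal.ofReal (Real.exp (x ^ 2 * Cg g - b)) := by
    rw [intensity, Measure.smul_apply, Measure.restrict_apply_univ, smul_eq_mul, volume_square,
      ← ENNReal.ofReal_pow (by positivity), ← ENNReal.ofReal_mul (by positivity),
      hL, sq_mul_sq_halfSide g b hx]
  calc ENNReal.ofReal (Real.exp (-(k * b)))
      = ∫⁻ _ : Fin k → Plane, ENNReal.ofReal (Real.exp (-(x ^ 2 * (k * Cg g))))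
          ∂(Measure.pi fun _ => intensity (x ^ 2) L) := by
        rw [lintegral_const, ← Set.pi_univ Set.univ, Measure.pi_pi]
        simp only [huniv, Finset.prod_const, Finset.card_univ, Fintype.card_fin]
        rw [← ENNReal.ofReal_pow (Real.exp_pos _).le, ← ENNReal.ofReal_mul (Real.exp_pos _).le,
          ← Real.exp_nat_mul, ← Real.exp_add]
        congr 2; ring
    _ ≤ _ := by
        refine lintegral_mono fun z => ?_
        have := mul_le_mul_of_nonneg_left (hhit z) (sq_nonneg x)
        exact ENNReal.ofReal_le_ofReal (Real.exp_le_exp.2 (by linarith))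

lemma pow_mul_compInt_eq (hg : IsConnection g) {b ρ : ℝ} (hlam : 0 ≤ lamDen g b ρ) (k : ℕ) :
    lamDen g b ρ ^ k * compInt g b ρ k =
      (partFun g (lamDen g b ρ) (1 / (2 * rRho g b ρ)) ![] k).toReal := by
  set lam := lamDen g b ρ
  set L := 1 / (2 * rRho g b ρ) with hL
  have hcomp : compInt g b ρ k = ∫ x : Fin k → Plane, Real.exp (-(lam * hit g L ![] x))
      ∂(Measure.pi fun _ => volume.restrict (square L)) := by
    simp only [hit, surv_zero, one_mul]
    rfl
  have hm := hg.measurable_hit ![] k L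
  rw [hcomp, integral_eq_lintegral_of_nonneg_ae (ae_of_all _ fun _ => (Real.exp_pos _).le)
    (by fun_prop), partFun]
  unfold intensity
  rw [pi_const_smul _ ENNReal.ofReal_ne_top, lintegral_smul_measure, smul_eq_mul,
    ENNReal.toReal_mul, ENNReal.toReal_pow, ENNReal.toReal_ofReal hlam]
  rfl

lemma le_liminf (hg : IsConnection g) (hC : 0 < Cg g)
    (hdec : ∀ᶠ x in atTop, g x ≤ 1 / (x ^ 2 * Real.log x ^ 2)) (b : ℝ) (k : ℕ) :
    Real.exp (-(k * b)) / (Nat.factorial k : ℝ) ≤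
      Filter.liminf (fun ρ : ℝ =>
        (lamDen g b ρ ^ k / (Nat.factorial k : ℝ)) * compInt g b ρ k) atTop := by
  obtain ⟨M, hMtop, hM⟩ := hg.exists_partFun_le hC hdec b k
  have hlam : Tendsto (lamDen g b) atTop atTop :=
    (tendsto_atTop_add_const_right _ b Real.tendsto_log_atTop).atTop_div_const hC
  have hrel : ∀ᶠ ρ : ℝ in atTop, 0 < √(lamDen g b ρ) ∧
      lamDen g b ρ ^ k / (Nat.factorial k : ℝ) * compInt g b ρ k =
      (partFun g (√(lamDen g b ρ) ^ 2) (halfSide g b √(lamDen g b ρ)) ![] k).toReal /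
        (Nat.factorial k : ℝ) := by
    filter_upwards [hlam.eventually_gt_atTop 0, eventually_gt_atTop 0] with ρ hl hρ
    have hb : 0 ≤ Real.log ρ + b := by
      have := mul_nonneg hl.le hC.le
      rwa [lamDen, div_mul_cancel₀ _ hC.ne'] at this
    refine ⟨Real.sqrt_pos.2 hl, ?_⟩
    rw [halfSide_sqrt_lamDen hC hρ hb, Real.sq_sqrt hl.le, ← hg.pow_mul_compInt_eq hl.le k]
    ring
  have hM' := (Real.tendsto_sqrt_atTop.comp hlam).eventually hM
  refine le_liminf_of_le (isCoboundedUnder_ge_of_eventually_le _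
    (x := M.toReal / (Nat.factorial k : ℝ)) ?_) ?_
  · filter_upwards [hrel, hM'] with ρ h1 h2
    rw [h1.2]
    gcongr
    exact h2
  · filter_upwards [hrel, hM'] with ρ h1 h2
    rw [h1.2]
    gcongr
    refine (ENNReal.ofReal_le_iff_le_toReal (ne_top_of_le_ne_top hMtop h2)).1 ?_
    exact hg.exp_neg_le_partFun b k h1.1

end IsConnection

lemma isConnection_max {g : ℝ → ℝ} (hmono : AntitoneOn g (Set.Ici (0 : ℝ)))
    (hrange : ∀ x ∈ Set.Ici (0 : ℝ), g x ∈ Set.Icc (0 : ℝ) 1)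
    (hint : Integrable (fun x : Plane => g ‖x‖)) : IsConnection fun x => g (max x 0) where
  anti x y hxy := hmono (le_max_right x 0) (le_max_right y 0) (max_le_max_right 0 hxy)
  nonneg x := (hrange _ (le_max_right x 0)).1
  le_one x := (hrange _ (le_max_right x 0)).2
  int := by simpa using hint

/-- for non-increasing `g : [0,∞) → [0,1]` with
`0 < C := ∫_{ℝ²} g(‖x‖) dx < ∞` and `g(x) = o(1/(x² log² x))`, `b ∈ ℝ` and a
fixed integer `k ≥ 1`,
`liminf_{ρ→∞} (λ_ρ^k/k!) ∫_{A_ρ^k} exp(−λ_ρ ∫_{A_ρ} g₂(y;x₁,…,x_k) dy)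
  d(x₁,…,x_k) ≥ e^{−kb}/k!`. -/
theorem liminf_component_integral_ge
    (g : ℝ → ℝ)
    (hmono : AntitoneOn g (Set.Ici (0 : ℝ)))
    (hrange : ∀ x ∈ Set.Ici (0 : ℝ), g x ∈ Set.Icc (0 : ℝ) 1)
    (hint : Integrable (fun x : EuclideanSpace ℝ (Fin 2) => g ‖x‖))
    (hpos : 0 < Cg g)
    (hlittleo : g =o[atTop] fun x : ℝ => 1 / (x ^ 2 * Real.log x ^ 2))
    (b : ℝ) (k : ℕ) (hk : 1 ≤ k) :
    Real.exp (-(k * b)) / (Nat.factorial k : ℝ) ≤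
      Filter.liminf (fun ρ : ℝ =>
        (lamDen g b ρ ^ k / (Nat.factorial k : ℝ)) * compInt g b ρ k)
        atTop := by
  have hC : Cg (fun x => g (max x 0)) = Cg g := by simp [Cg]
  have hlam : lamDen (fun x => g (max x 0)) b = lamDen g b := by
    ext ρ; simp only [lamDen, hC]
  have hr : rRho (fun x => g (max x 0)) b = rRho g b := by
    ext ρ; simp only [rRho, hC]
  have hcomp : ∀ ρ, compInt (fun x => g (max x 0)) b ρ k = compInt g b ρ k := by
    intro ρ
    simp [compInt, sqA, hlam, hr]
  have hdec : ∀ᶠ x in atTop, g (max x 0) ≤ 1 / (x ^ 2 * Real.log x ^ 2) := by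
    filter_upwards [hlittleo.bound one_pos, eventually_ge_atTop 0] with x hx hx0
    rw [max_eq_left hx0]
    refine (le_abs_self _).trans (hx.trans_eq ?_)
    rw [one_mul, Real.norm_of_nonneg (by positivity)]
  have h := (isConnection_max hmono hrange hint).le_liminf (hC ▸ hpos) hdec b k
  simpa only [hlam, hcomp] using h
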